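/- arXiv:2010.06058 — 2 statements merged into one kernel-verified Lean document; each statement's English description precedes it below -/
import Mathlib

section
/- Suppose g satisfies condition (U) and the Hölder condition |g'(u) − g'(0)| ≤ A u^γ on [0,δ], and let φ be a semi-wavefront profile of speed c for u_t = u_xx − u + g(u(t−h,x)). If c > c_#(h), then for an appropriate s₀ ∈ ℝ, some j ∈ {1,2} and some σ > 0: φ(t+s₀) = e^{λ_j t} + O(e^{(λ_j+σ)t}) and φ'(t+s₀) = λ_j e^{λ_j t} + O(e^{(λ_j+σ)t}) as t → −∞. If c = c_#(h), denoting by λ the double positive root of χ(·,c), there are nonnegative A, B with A + B > 0 such that φ(t+s₀) = (−At+B)e^{λ t} + O(e^{λ t}) and φ'(t+s₀) = λ(−At+B)e^{λ t} + O(e^{λ t}) as t → −∞. -/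
open Filter Set Asymptotics

noncomputable section

/-- The wave profile equation `φ'' - cφ' - φ + g(φ(· - ch)) = 0`. -/
def ProfileEq (g : ℝ → ℝ) (c h : ℝ) (φ : ℝ → ℝ) : Prop :=
  ∀ t : ℝ, deriv (deriv φ) t - c * deriv φ t - φ t + g (φ (t - c * h)) = 0

/-- A semi-wavefront profile of speed `c`: positive, `C²`, solving the profile equation,
with `φ(-∞) = 0` and `liminf_{t→+∞} φ(t) > 0`. -/
def SemiWavefront (g : ℝ → ℝ) (c h : ℝ) (φ : ℝ → ℝ) : Prop :=
  (∀ t, 0 < φ t) ∧ ContDiff ℝ 2 φ ∧ ProfileEq g c h φ ∧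
    Tendsto φ atBot (nhds 0) ∧ 0 < Filter.liminf φ atTop

/-- The characteristic function `χ(z,c) = z² - cz - 1 + b e^{-zch}` at the zero
equilibrium, where `b = g'(0)`. -/
def chi0 (b c h z : ℝ) : ℝ := z ^ 2 - c * z - 1 + b * Real.exp (-(z * c * h))


def EO (f : ℝ → ℝ) (a : ℝ) : Prop := f =O[atBot] fun t => Real.exp (a * t)

lemma EO.bound {f : ℝ → ℝ} {a : ℝ} (hf : EO f a) :
    ∃ C > 0, ∃ t0, ∀ t ≤ t0, |f t| ≤ C * Real.exp (a * t) := by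
  obtain ⟨C, hC, h⟩ := IsBigO.exists_pos hf
  rw [isBigOWith_iff] at h
  obtain ⟨t0, h⟩ := eventually_atBot.1 h
  refine ⟨C, hC, t0, fun t ht => ?_⟩
  have := h t ht
  rwa [Real.norm_eq_abs, Real.norm_eq_abs, Real.abs_exp] at this

lemma EO.of_bound {f : ℝ → ℝ} {a C t0 : ℝ} (h : ∀ t ≤ t0, |f t| ≤ C * Real.exp (a * t)) :
    EO f a := by
  refine IsBigO.of_bound C ?_
  refine eventually_atBot.2 ⟨t0, fun t ht => ?_⟩
  rw [Real.norm_eq_abs, Real.norm_eq_abs, Real.abs_exp]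
  exact h t ht

lemma EO.exp (a : ℝ) : EO (fun t => Real.exp (a * t)) a := isBigO_refl _ _

lemma EO.mono {f : ℝ → ℝ} {a b : ℝ} (hf : EO f a) (hab : b ≤ a) : EO f b := by
  refine IsBigO.trans hf ?_
  refine EO.of_bound (C := 1) (t0 := 0) fun t ht => ?_
  rw [Real.abs_exp, one_mul]
  apply Real.exp_le_exp.2
  nlinarith

lemma EO.add {f g : ℝ → ℝ} {a : ℝ} (hf : EO f a) (hg : EO g a) : EO (fun t => f t + g t) a :=
  IsBigO.add hf hg
lemma EO.sub {f g : ℝ → ℝ} {a : ℝ} (hf : EO f a) (hg : EO g a) : EO (fun t => f t - g t) a :=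
  IsBigO.sub hf hg
lemma EO.neg {f : ℝ → ℝ} {a : ℝ} (hf : EO f a) : EO (fun t => - f t) a :=
  IsBigO.neg_left hf
lemma EO.const_mul {f : ℝ → ℝ} {a : ℝ} (m : ℝ) (hf : EO f a) : EO (fun t => m * f t) a :=
  IsBigO.const_mul_left hf m
lemma EO.mul {f g : ℝ → ℝ} {a b : ℝ} (hf : EO f a) (hg : EO g b) :
    EO (fun t => f t * g t) (a + b) := by
  have := IsBigO.mul hf hg
  unfold EO
  simpa only [add_mul, Real.exp_add] using this
lemma EO.congr' {f g : ℝ → ℝ} {a b : ℝ} (hf : EO f a) (h : ∀ t, g t = f t) (hab : b = a) :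
    EO g b := by
  obtain rfl : g = f := funext h
  rw [hab]; exact hf
lemma EO.const (m : ℝ) : EO (fun _ => m) 0 := by
  refine EO.of_bound (C := |m|) (t0 := 0) fun t _ => by simp
lemma EO.shift {f : ℝ → ℝ} {a : ℝ} (hf : EO f a) (s : ℝ) : EO (fun t => f (t - s)) a := by
  obtain ⟨C, hC, t0, h⟩ := hf.bound
  refine EO.of_bound (C := C * Real.exp (-(a * s))) (t0 := t0 + s) fun t ht => ?_
  have := h (t - s) (by linarith)
  rw [mul_assoc, ← Real.exp_add]
  convert this using 3
  ring

lemma tendsto_exp_mul_atBot {a : ℝ} (ha : 0 < a) :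
    Tendsto (fun t => Real.exp (a * t)) atBot (nhds 0) := by
  apply Real.tendsto_exp_atBot.comp
  exact (tendsto_const_mul_atBot_of_pos ha).2 tendsto_id

lemma EO.tendsto {f : ℝ → ℝ} {a : ℝ} (hf : EO f a) (ha : 0 < a) : Tendsto f atBot (nhds 0) :=
  IsBigO.trans_tendsto hf (tendsto_exp_mul_atBot ha)

lemma nonneg_of_deriv {H h : ℝ → ℝ} {t0 : ℝ} (hd : ∀ t, HasDerivAt H (h t) t)
    (hh : ∀ t ≤ t0, 0 ≤ h t) (hl : Tendsto H atBot (nhds 0)) : ∀ t ≤ t0, 0 ≤ H t := by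
  intro t ht
  have hm : MonotoneOn H (Iic t0) := by
    apply monotoneOn_of_deriv_nonneg (convex_Iic t0)
    · exact fun x _ => (hd x).continuousAt.continuousWithinAt
    · exact fun x _ => (hd x).differentiableAt.differentiableWithinAt
    · intro x hx
      rw [(hd x).deriv]
      exact hh x (mem_Iic.1 (interior_subset hx))
  refine le_of_tendsto hl ?_
  filter_upwards [eventually_le_atBot t] with s hs
  exact hm (show s ≤ t0 by linarith) ht hs

lemma abs_le_of_deriv {F f G g : ℝ → ℝ} {t0 : ℝ} (hF : ∀ t, HasDerivAt F (f t) t)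
    (hG : ∀ t, HasDerivAt G (g t) t) (hh : ∀ t ≤ t0, |f t| ≤ g t)
    (hlF : Tendsto F atBot (nhds 0)) (hlG : Tendsto G atBot (nhds 0)) :
    ∀ t ≤ t0, |F t| ≤ G t := by
  intro t ht
  have h1 := nonneg_of_deriv (t0 := t0) (fun t => (hG t).sub (hF t))
    (fun t ht => by have := abs_le.1 (hh t ht); simp; linarith) (by have := hlG.sub hlF; rw [sub_zero] at this; exact this) t ht
  have h2 := nonneg_of_deriv (t0 := t0) (fun t => (hG t).add (hF t))
    (fun t ht => by have := abs_le.1 (hh t ht); linarith) (by have := hlG.add hlF; rw [add_zero] at this; exact this) t ht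
  simp at h1 h2
  rw [abs_le]; constructor <;> linarith

lemma EO.antideriv {f : ℝ → ℝ} {a : ℝ} (hf : EO f a) (ha : 0 < a) (hc : Continuous f) :
    ∃ F : ℝ → ℝ, (∀ t, HasDerivAt F (f t) t) ∧ EO F a := by
  obtain ⟨C, hC, t0, h⟩ := hf.bound
  have hint0 : MeasureTheory.IntegrableOn (fun x => C * Real.exp (a * x)) (Iic t0) :=
    (integrableOn_exp_mul_Iic ha t0).const_mul C
  have hint : MeasureTheory.IntegrableOn f (Iic t0) := by
    refine MeasureTheory.Integrable.mono' hint0 hc.aestronglyMeasurable ?_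
    refine (MeasureTheory.ae_restrict_iff' measurableSet_Iic).2 (Eventually.of_forall fun x hx => ?_)
    exact h x hx
  let F : ℝ → ℝ := fun t => (∫ x in Iic t0, f x) + ∫ x in t0..t, f x
  have hFd : ∀ t, HasDerivAt F (f t) t := by
    intro t
    have := (intervalIntegral.integral_hasDerivAt_right (hc.intervalIntegrable t0 t)
      (hc.stronglyMeasurableAtFilter _ _) hc.continuousAt)
    simpa [F] using this.const_add (∫ x in Iic t0, f x)
  refine ⟨F, hFd, ?_⟩
  refine EO.of_bound (C := C / a) (t0 := t0) fun t ht => ?_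
  have hFt : F t = ∫ x in Iic t, f x := by
    have := intervalIntegral.integral_Iic_sub_Iic (hint.mono_set (Iic_subset_Iic.2 ht)) hint
    simp only [F]
    rw [intervalIntegral.integral_symm]
    linarith
  rw [hFt, ← Real.norm_eq_abs]
  calc ‖∫ x in Iic t, f x‖ ≤ ∫ x in Iic t, C * Real.exp (a * x) := by
        refine MeasureTheory.norm_integral_le_of_norm_le (hint0.mono_set (Iic_subset_Iic.2 ht)) ?_
        refine (MeasureTheory.ae_restrict_iff' measurableSet_Iic).2
          (Eventually.of_forall fun x hx => ?_)
        exact h x (le_trans hx ht)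
    _ = C / a * Real.exp (a * t) := by
        rw [MeasureTheory.integral_const_mul, integral_exp_mul_Iic ha]
        ring


structure Prof (φ φ1 φ2 R : ℝ → ℝ) (b c τ : ℝ) : Prop where
  pos : ∀ t, 0 < φ t
  d1 : ∀ t, HasDerivAt φ (φ1 t) t
  d2 : ∀ t, HasDerivAt φ1 (φ2 t) t
  cont2 : Continuous φ2
  contR : Continuous R
  eq : ∀ t, φ2 t - c * φ1 t - φ t + b * φ (t - τ) = R t
  small : ∀ η > 0, ∃ t0, ∀ t ≤ t0, |R t| ≤ η * φ (t - τ)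
  lim : Tendsto φ atBot (nhds 0)
  hb : 1 < b
  hc : 0 < c
  hτ : 0 ≤ τ
  upper : ∀ t, R t ≤ b * φ (t - τ)

lemma Prof.EO_R {φ φ1 φ2 R : ℝ → ℝ} {b c τ a : ℝ} (P : Prof φ φ1 φ2 R b c τ) (h : EO φ a) :
    EO R a := by
  obtain ⟨t0, h0⟩ := P.small 1 one_pos
  refine IsBigO.trans ?_ (h.shift τ)
  refine IsBigO.of_bound 1 ?_
  refine eventually_atBot.2 ⟨t0, fun t ht => ?_⟩
  rw [Real.norm_eq_abs, Real.norm_eq_abs, abs_of_pos (P.pos (t - τ))]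
  exact h0 t ht

lemma exp_near {a u t : ℝ} (h1 : t - 1 ≤ u) (h2 : u ≤ t) :
    Real.exp (a * u) ≤ Real.exp |a| * Real.exp (a * t) := by
  rw [← Real.exp_add]
  apply Real.exp_le_exp.2
  rcases abs_cases a with ⟨h, _⟩ | ⟨h, _⟩ <;> rw [h] <;> nlinarith

lemma Prof.EO_d {φ φ1 φ2 R : ℝ → ℝ} {b c τ a : ℝ} (P : Prof φ φ1 φ2 R b c τ) (h : EO φ a) :
    EO φ1 a := by
  have hf : EO (fun t => φ t - b * φ (t - τ) + R t) a :=
    (h.sub ((h.shift τ).const_mul b)).add (P.EO_R h)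
  obtain ⟨C1, hC1, t1, h1⟩ := h.bound
  obtain ⟨C2, hC2, t2, h2⟩ := hf.bound
  have hp : ∀ t, HasDerivAt (fun t => φ1 t - c * φ t) (φ t - b * φ (t - τ) + R t) t := by
    intro t
    have := (P.d2 t).sub ((P.d1 t).const_mul c)
    exact HasDerivAt.congr_deriv this (by linarith [P.eq t])
  have hc := P.hc
  set E := Real.exp |a| with hE
  refine EO.of_bound (C := C1 * (1 + E) + c * C1 * E + C2 * E + c * C1) (t0 := min t1 t2)
    fun t ht => ?_
  have ht1 : t ≤ t1 := ht.trans (min_le_left _ _)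
  have ht2 : t ≤ t2 := ht.trans (min_le_right _ _)
  set e := Real.exp (a * t) with he
  have he0 : 0 < e := Real.exp_pos _
  have hE0 : 0 < E := Real.exp_pos _
  obtain ⟨ξ, ⟨hξ1, hξ2⟩, hξ⟩ := exists_hasDerivAt_eq_slope φ φ1 (show t - 1 < t by linarith)
    (fun x _ => (P.d1 x).continuousAt.continuousWithinAt) (fun x _ => P.d1 x)
  have hξ' : φ1 ξ = φ t - φ (t - 1) := by rw [hξ]; simp
  obtain ⟨ζ, ⟨hζ1, hζ2⟩, hζ⟩ := exists_hasDerivAt_eq_slope (fun t => φ1 t - c * φ t) _ hξ2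
    (fun x _ => (hp x).continuousAt.continuousWithinAt) (fun x _ => hp x)
  have hζ' : (φ1 t - c * φ t) - (φ1 ξ - c * φ ξ)
      = (φ ζ - b * φ (ζ - τ) + R ζ) * (t - ξ) := by
    rw [hζ]; field_simp [show t - ξ ≠ 0 by linarith]
  have b1 : |φ t| ≤ C1 * e := h1 t ht1
  have b2 : |φ (t - 1)| ≤ C1 * (E * e) :=
    (h1 (t - 1) (by linarith)).trans (by gcongr; exact exp_near le_rfl (by linarith))
  have b3 : |φ ξ| ≤ C1 * (E * e) :=
    (h1 ξ (by linarith)).trans (by gcongr; exact exp_near hξ1.le (by linarith))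
  have b4 : |(φ ζ - b * φ (ζ - τ) + R ζ)| ≤ C2 * (E * e) :=
    (h2 ζ (by linarith)).trans (by gcongr; exact exp_near (by linarith) (by linarith))
  have b5 : |(φ ζ - b * φ (ζ - τ) + R ζ) * (t - ξ)| ≤ C2 * (E * e) := by
    rw [abs_mul, abs_of_pos (show 0 < t - ξ by linarith)]
    have := abs_nonneg (φ ζ - b * φ (ζ - τ) + R ζ)
    nlinarith
  have key : φ1 t = (φ ζ - b * φ (ζ - τ) + R ζ) * (t - ξ) + φ t - φ (t - 1) - c * φ ξ + c * φ t := by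
    rw [← hζ', hξ']; ring
  rw [abs_le] at b1 b2 b3 b5 ⊢
  rw [key]
  constructor <;> nlinarith

def chiF (b c τ z : ℝ) : ℝ := z ^ 2 - c * z - 1 + b * Real.exp (-(z * τ))

lemma hasDerivAt_expneg (σ t : ℝ) :
    HasDerivAt (fun t => Real.exp (-(σ * t))) (-(σ * Real.exp (-(σ * t)))) t := by
  have := (((hasDerivAt_id t).const_mul σ).neg).exp
  simp at this
  convert this using 1
  ring

lemma Prof.improve {φ φ1 φ2 R : ℝ → ℝ} {b c τ s : ℝ} (P : Prof φ φ1 φ2 R b c τ)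
    (h : ∀ σ < s, EO φ σ) (hs : chiF b c τ s ≠ 0) : ∃ σ > s, EO φ σ := by
  have hc := P.hc
  have hτ := P.hτ
  have hb := P.hb
  set a := |chiF b c τ s| / 4 with ha
  have ha0 : 0 < a := by have := abs_pos.2 hs; positivity
  have hcont : Continuous (chiF b c τ) := by unfold chiF; fun_prop
  obtain ⟨ε0, hε0, hχ⟩ : ∃ ε0 > 0, ∀ σ, |σ - s| < ε0 → 2 * a ≤ |chiF b c τ σ| := by
    have := (hcont.abs.tendsto s).eventually (lt_mem_nhds (show 2 * a < |chiF b c τ s| by linarith))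
    obtain ⟨ε, hε, h⟩ := Metric.eventually_nhds_iff.1 this
    exact ⟨ε, hε, fun σ hσ => (h (by rwa [Real.dist_eq])).le⟩
  set E := Real.exp ((|s| + 1) * τ) with hE
  have hE0 : 0 < E := Real.exp_pos _
  set K := 2 * (|s| + 1) + c + b * E * τ with hK
  have hK0 : 0 < K := by positivity
  set q := min 1 (a / (K + 1)) with hq
  have hq0 : 0 < q := lt_min one_pos (by positivity)
  have hq1 : q ≤ 1 := min_le_left _ _
  have hqa : (K + q) * q ≤ a := by
    have : q ≤ a / (K + 1) := min_le_right _ _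
    rw [le_div_iff₀ (by positivity)] at this
    nlinarith
  set m := min ε0 q with hm
  have hm0 : 0 < m := lt_min hε0 hq0
  have hmε : m ≤ ε0 := min_le_left _ _
  have hmq : m ≤ q := min_le_right _ _
  set σ := s - m / 2 with hσ
  have hχσ := hχ σ (by rw [hσ, abs_lt]; constructor <;> linarith)
  have hσs : |σ| ≤ |s| + 1 := by
    rcases abs_cases s with ⟨h, _⟩ | ⟨h, _⟩ <;> rw [h, abs_le] <;> constructor <;> linarith
  have hEσ : Real.exp (-(σ * τ)) ≤ E := by
    apply Real.exp_le_exp.2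
    have := (abs_le.1 hσs).1
    nlinarith
  refine ⟨σ + q, by linarith, ?_⟩
  -- weighted function
  have hφ : EO φ (σ + m / 4) := h _ (by linarith)
  have hφ1 := P.EO_d hφ
  have hm4 : 0 < m / 4 := by linarith
  set ε := m / 4 with hε
  have hexp : EO (fun t => Real.exp (-(σ * t))) (-σ) :=
    (EO.exp (-σ)).congr' (fun t => by ring_nf) rfl
  set w : ℝ → ℝ := fun t => Real.exp (-(σ * t)) * φ t with hw
  set w1 : ℝ → ℝ := fun t => Real.exp (-(σ * t)) * (φ1 t - σ * φ t) with hw1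
  set w2 : ℝ → ℝ := fun t => Real.exp (-(σ * t)) * (φ2 t - 2 * σ * φ1 t + σ ^ 2 * φ t) with hw2
  have hwE : EO w ε := (hexp.mul hφ).congr' (fun t => rfl) (by ring)
  have hw1E : EO w1 ε := (hexp.mul (hφ1.sub (hφ.const_mul σ))).congr' (fun t => rfl) (by ring)
  have hwd : ∀ t, HasDerivAt w (w1 t) t := fun t => by
    refine HasDerivAt.congr_deriv ((hasDerivAt_expneg σ t).mul (P.d1 t)) ?_
    simp only [hw1]; ring
  have hw1d : ∀ t, HasDerivAt w1 (w2 t) t := fun t => by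
    refine HasDerivAt.congr_deriv ((hasDerivAt_expneg σ t).mul ((P.d2 t).sub ((P.d1 t).const_mul σ))) ?_
    simp only [hw2]; ring
  have hwpos : ∀ t, 0 < w t := fun t => mul_pos (Real.exp_pos _) (P.pos t)
  have hwc : Continuous w := continuous_iff_continuousAt.2 fun t => (hwd t).continuousAt
  obtain ⟨Ψ, hΨd, hΨE⟩ := hwE.antideriv hm4 hwc
  have hΨc : Continuous Ψ := continuous_iff_continuousAt.2 fun t => (hΨd t).continuousAt
  obtain ⟨X, hXd, hXE⟩ := hΨE.antideriv hm4 hΨc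
  have hΨ0 : ∀ t, 0 ≤ Ψ t := fun t =>
    nonneg_of_deriv hΨd (fun t _ => (hwpos t).le) (hΨE.tendsto hm4) t le_rfl
  have hX0 : ∀ t, 0 ≤ X t := fun t =>
    nonneg_of_deriv hXd (fun t _ => hΨ0 t) (hXE.tendsto hm4) t le_rfl
  have hΨm : Monotone Ψ := monotone_of_hasDerivAt_nonneg hΨd (fun t => (hwpos t).le)
  have hXm : Monotone X := monotone_of_hasDerivAt_nonneg hXd (fun t => hΨ0 t)
  have hXτ : ∀ t, X t - X (t - τ) ≤ τ * Ψ t := by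
    intro t
    rcases hτ.eq_or_lt with h0 | h0
    · rw [← h0]; simp
    · obtain ⟨ξ, ⟨hξ1, hξ2⟩, hξ⟩ := exists_hasDerivAt_eq_slope X Ψ (show t - τ < t by linarith)
        (fun x _ => (hXd x).continuousAt.continuousWithinAt) (fun x _ => hXd x)
      have : X t - X (t - τ) = τ * Ψ ξ := by rw [hξ, show t - (t - τ) = τ by ring]; field_simp
      rw [this]
      exact mul_le_mul_of_nonneg_left (hΨm hξ2.le) hτ
  set x := chiF b c τ σ with hx
  set β := b * Real.exp (-(σ * τ)) with hβ
  have hβ0 : 0 < β := by positivity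
  have hβE : β ≤ b * E := mul_le_mul_of_nonneg_left hEσ (by linarith)
  have shiftd : ∀ {F f : ℝ → ℝ}, (∀ t, HasDerivAt F (f t) t) →
      ∀ t, HasDerivAt (fun t => F (t - τ)) (f (t - τ)) t := fun hF t => by
    exact (hF (t - τ)).comp_sub_const t τ
  set G : ℝ → ℝ := fun t => w t + (2 * σ - c) * Ψ t + x * X t - β * (X t - X (t - τ)) with hG
  set G1 : ℝ → ℝ := fun t => w1 t + (2 * σ - c) * w t + x * Ψ t - β * (Ψ t - Ψ (t - τ)) with hG1
  have hGd : ∀ t, HasDerivAt G (G1 t) t := fun t =>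
    (((hwd t).add ((hΨd t).const_mul _)).add ((hXd t).const_mul x)).sub
      (((hXd t).sub (shiftd hXd t)).const_mul β)
  have hG1d : ∀ t, HasDerivAt G1 (Real.exp (-(σ * t)) * R t) t := fun t => by
    refine HasDerivAt.congr_deriv ((((hw1d t).add ((hwd t).const_mul _)).add ((hΨd t).const_mul x)).sub
      (((hΨd t).sub (shiftd hΨd t)).const_mul β)) ?_
    have he : Real.exp (-(σ * τ)) * Real.exp (-(σ * (t - τ))) = Real.exp (-(σ * t)) := by
      rw [← Real.exp_add]; ring_nf
    simp only [hw2, hw1, hw, hβ, hx, chiF]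
    rw [← P.eq t]
    linear_combination (b * φ (t - τ)) * he
  have hGE : EO G ε := ((hwE.add (hΨE.const_mul _)).add (hXE.const_mul x)).sub
    ((hXE.sub (hXE.shift τ)).const_mul β)
  have hG1E : EO G1 ε := ((hw1E.add (hwE.const_mul _)).add (hΨE.const_mul x)).sub
    ((hΨE.sub (hΨE.shift τ)).const_mul β)
  obtain ⟨t0, ht0⟩ := P.small (a / E) (by positivity)
  have hRb : ∀ t ≤ t0, |Real.exp (-(σ * t)) * R t| ≤ a * w (t - τ) := by
    intro t ht
    rw [abs_mul, Real.abs_exp]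
    have he : Real.exp (-(σ * τ)) * Real.exp (-(σ * (t - τ))) = Real.exp (-(σ * t)) := by
      rw [← Real.exp_add]; ring_nf
    calc Real.exp (-(σ * t)) * |R t| ≤ Real.exp (-(σ * t)) * (a / E * φ (t - τ)) := by
          gcongr; exact ht0 t ht
      _ = (a / E * Real.exp (-(σ * τ))) * w (t - τ) := by rw [← he]; simp only [hw]; ring
      _ ≤ (a / E * E) * w (t - τ) := by
          have := hwpos (t - τ)
          gcongr
      _ = a * w (t - τ) := by field_simp
  have hG1b := abs_le_of_deriv (t0 := t0) hG1d (fun t => (shiftd hΨd t).const_mul a) hRb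
    (hG1E.tendsto hm4) (((hΨE.shift τ).const_mul a).tendsto hm4)
  have hGb := abs_le_of_deriv (t0 := t0) hGd (fun t => (shiftd hXd t).const_mul a) hG1b
    (hGE.tendsto hm4) (((hXE.shift τ).const_mul a).tendsto hm4)
  have hGb' : ∀ t ≤ t0, |G t| ≤ a * X t := fun t ht => (hGb t ht).trans (by
    have := hXm (show t - τ ≤ t by linarith)
    gcongr)
  have hσc : |2 * σ - c| ≤ 2 * (|s| + 1) + c := by
    have := abs_le.1 hσs
    rw [abs_le]; constructor <;> linarith
  have hrest : ∀ t, |(2 * σ - c) * Ψ t - β * (X t - X (t - τ))| ≤ K * Ψ t := by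
    intro t
    have h1 : |(2 * σ - c) * Ψ t| ≤ (2 * (|s| + 1) + c) * Ψ t := by
      rw [abs_mul, abs_of_nonneg (hΨ0 t)]
      exact mul_le_mul_of_nonneg_right hσc (hΨ0 t)
    have h2 : |β * (X t - X (t - τ))| ≤ b * E * τ * Ψ t := by
      rw [abs_mul, abs_of_pos hβ0, abs_of_nonneg (sub_nonneg.2 (hXm (show t - τ ≤ t by linarith)))]
      calc β * (X t - X (t - τ)) ≤ β * (τ * Ψ t) := by
            gcongr; exact hXτ t
        _ ≤ (b * E) * (τ * Ψ t) := by
            have := hΨ0 t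
            gcongr
        _ = _ := by ring
    calc _ ≤ _ := abs_sub _ _
      _ ≤ _ := add_le_add h1 h2
      _ = _ := by rw [hK]; ring
  have hineq : ∀ t ≤ t0, a * X t ≤ w t + K * Ψ t := by
    intro t ht
    have h1 := abs_le.1 (hGb' t ht)
    have h2 := abs_le.1 (hrest t)
    have h3 : |x * X t| ≤ a * X t + (w t + K * Ψ t) := by
      have := hwpos t
      have e : x * X t = G t - w t - ((2 * σ - c) * Ψ t - β * (X t - X (t - τ))) := by
        simp only [hG]; ring
      rw [e, abs_le]; constructor <;> linarith
    rw [abs_mul, abs_of_nonneg (hX0 t)] at h3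
    have := mul_le_mul_of_nonneg_right hχσ (hX0 t)
    linarith
  -- V
  have hVd : ∀ t, HasDerivAt (fun t => Real.exp (-(q * t)) * (Ψ t + (K + q) * X t))
      (Real.exp (-(q * t)) * (w t + K * Ψ t - (K + q) * q * X t)) t := fun t => by
    refine HasDerivAt.congr_deriv ((hasDerivAt_expneg q t).mul ((hΨd t).add ((hXd t).const_mul (K + q)))) ?_
    ring
  have hVm : MonotoneOn (fun t => Real.exp (-(q * t)) * (Ψ t + (K + q) * X t)) (Iic t0) := by
    apply monotoneOn_of_deriv_nonneg (convex_Iic t0)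
    · exact fun x _ => (hVd x).continuousAt.continuousWithinAt
    · exact fun x _ => (hVd x).differentiableAt.differentiableWithinAt
    · intro t ht
      rw [(hVd t).deriv]
      have ht' : t ≤ t0 := mem_Iic.1 (interior_subset ht)
      have := hineq t ht'
      have h2 := mul_le_mul_of_nonneg_right hqa (hX0 t)
      exact mul_nonneg (Real.exp_pos _).le (by linarith)
  set M := Real.exp (-(q * t0)) * (Ψ t0 + (K + q) * X t0) with hM
  have hVb : ∀ t ≤ t0, Ψ t + (K + q) * X t ≤ M * Real.exp (q * t) := by
    intro t ht
    have h1 : Real.exp (-(q * t)) * (Ψ t + (K + q) * X t) ≤ M := hVm ht (mem_Iic.2 le_rfl) ht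
    have h2 : Real.exp (q * t) * Real.exp (-(q * t)) = 1 := by rw [← Real.exp_add]; simp
    have h3 := mul_le_mul_of_nonneg_right h1 (Real.exp_pos (q * t)).le
    calc _ = (Ψ t + (K + q) * X t) * 1 := by ring
      _ = Real.exp (-(q * t)) * (Ψ t + (K + q) * X t) * Real.exp (q * t) := by rw [← h2]; ring
      _ ≤ _ := h3
  have hΨE' : EO Ψ q := EO.of_bound (C := M) (t0 := t0) fun t ht => by
    rw [abs_of_nonneg (hΨ0 t)]
    have := mul_nonneg (show 0 ≤ K + q by linarith) (hX0 t)
    linarith [hVb t ht]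
  have hXE' : EO X q := by
    have : EO (fun t => (K + q) * X t) q := EO.of_bound (C := M) (t0 := t0) fun t ht => by
      have := mul_nonneg (show 0 ≤ K + q by linarith) (hX0 t)
      rw [abs_of_nonneg this]
      linarith [hVb t ht, hΨ0 t]
    refine (this.const_mul (K + q)⁻¹).congr' (fun t => ?_) rfl
    have : K + q ≠ 0 := by linarith
    field_simp
  have hGE' : EO G q := by
    obtain ⟨C, hC, t1, h1⟩ := (hXE'.const_mul a).bound
    refine EO.of_bound (C := C) (t0 := min t0 t1) fun t ht => ?_
    exact (hGb' t (ht.trans (min_le_left _ _))).trans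
      ((le_abs_self _).trans (h1 t (ht.trans (min_le_right _ _))))
  have hwE' : EO w q := by
    refine (((hGE'.sub (hΨE'.const_mul (2 * σ - c))).sub (hXE'.const_mul x)).add
      ((hXE'.sub (hXE'.shift τ)).const_mul β)).congr' (fun t => ?_) rfl
    simp only [hG]; ring
  refine ((EO.exp σ).mul hwE').congr' (fun t => ?_) rfl
  simp only [hw]
  rw [← mul_assoc, ← Real.exp_add]; simp

lemma Prof.not_EO {φ φ1 φ2 R : ℝ → ℝ} {b c τ : ℝ} (P : Prof φ φ1 φ2 R b c τ) :
    ¬ EO φ (c + 2) := by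
  intro hφ
  have hc := P.hc
  have hφ1 := P.EO_d hφ
  set σ := c + 1 with hσ
  have hexp : EO (fun t => Real.exp (-(σ * t))) (-σ) :=
    (EO.exp (-σ)).congr' (fun t => by ring_nf) rfl
  set w : ℝ → ℝ := fun t => Real.exp (-(σ * t)) * φ t with hw
  set w1 : ℝ → ℝ := fun t => Real.exp (-(σ * t)) * (φ1 t - σ * φ t) with hw1
  set w2 : ℝ → ℝ := fun t => Real.exp (-(σ * t)) * (φ2 t - 2 * σ * φ1 t + σ ^ 2 * φ t) with hw2
  have hwE : EO w 1 := (hexp.mul hφ).congr' (fun t => rfl) (by rw [hσ]; ring)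
  have hw1E : EO w1 1 := (hexp.mul (hφ1.sub (hφ.const_mul σ))).congr' (fun t => rfl)
    (by rw [hσ]; ring)
  have hwd : ∀ t, HasDerivAt w (w1 t) t := fun t => by
    refine HasDerivAt.congr_deriv ((hasDerivAt_expneg σ t).mul (P.d1 t)) ?_
    simp only [hw1]; ring
  have hw1d : ∀ t, HasDerivAt w1 (w2 t) t := fun t => by
    refine HasDerivAt.congr_deriv ((hasDerivAt_expneg σ t).mul ((P.d2 t).sub ((P.d1 t).const_mul σ))) ?_
    simp only [hw2]; ring
  have hwpos : ∀ t, 0 < w t := fun t => mul_pos (Real.exp_pos _) (P.pos t)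
  have h1 : ∀ t, 0 ≤ -(w1 t + (c + 2) * w t) := fun t => by
    refine nonneg_of_deriv (H := fun t => -(w1 t + (c + 2) * w t)) (t0 := t)
      (fun t => ((hw1d t).add ((hwd t).const_mul (c + 2))).neg) (fun t _ => ?_) ?_ t le_rfl
    · have e : w2 t + (c + 2) * w1 t = Real.exp (-(σ * t)) * (R t - b * φ (t - τ) - c * φ t) := by
        simp only [hw2, hw1]
        rw [← P.eq t, hσ]; ring
      rw [e, ← mul_neg]
      have := P.upper t
      have h3 := mul_pos hc (P.pos t)
      exact mul_nonneg (Real.exp_pos _).le (by linarith)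
    · exact ((hw1E.add (hwE.const_mul _)).neg).tendsto one_pos
  have h2 : 0 ≤ - w 0 := by
    refine nonneg_of_deriv (H := fun t => - w t) (t0 := 0)
      (fun t => (hwd t).neg) (fun t _ => ?_) ?_ 0 le_rfl
    · have := h1 t
      have h3 := mul_pos (show 0 < c + 2 by linarith) (hwpos t)
      linarith
    · exact hwE.neg.tendsto one_pos
  linarith [hwpos 0]

lemma Prof.abscissa {φ φ1 φ2 R : ℝ → ℝ} {b c τ : ℝ} (P : Prof φ φ1 φ2 R b c τ) :
    ∃ s > 0, chiF b c τ s = 0 ∧ (∀ σ < s, EO φ σ) ∧ ∀ σ > s, ¬ EO φ σ := by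
  set S := {σ | EO φ σ} with hS
  have hbdd : BddAbove S := ⟨c + 2, fun σ hσ => by
    by_contra hcon
    exact P.not_EO (EO.mono hσ (not_le.1 hcon).le)⟩
  have h0 : (0 : ℝ) ∈ S := by
    have := P.lim.isBigO_one ℝ
    simpa [hS, EO] using this
  have hlt : ∀ σ < sSup S, EO φ σ := fun σ hσ => by
    obtain ⟨x, hx, h⟩ := exists_lt_of_lt_csSup ⟨0, h0⟩ hσ
    exact EO.mono hx h.le
  have hgt : ∀ σ > sSup S, ¬ EO φ σ := fun σ hσ h => by
    have := le_csSup hbdd (show σ ∈ S from h)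
    linarith
  have hroot : chiF b c τ (sSup S) = 0 := by
    by_contra hne
    obtain ⟨σ, hσ, h⟩ := P.improve hlt hne
    exact hgt σ hσ h
  refine ⟨sSup S, ?_, hroot, hlt, hgt⟩
  refine lt_of_le_of_ne (le_csSup hbdd h0) fun h => ?_
  rw [← h] at hroot
  have := P.hb
  simp [chiF] at hroot
  linarith

lemma conv_deriv {k F f : ℝ → ℝ} {τ : ℝ} (hk : Continuous k) (hf : Continuous f)
    (hF : ∀ t, HasDerivAt F (f t) t) (t : ℝ) :
    HasDerivAt (fun t => ∫ s in (0 : ℝ)..τ, k s * (F t - F (t - s)))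
      (∫ s in (0 : ℝ)..τ, k s * (f t - f (t - s))) t := by
  have hFc : Continuous F := continuous_iff_continuousAt.2 fun t => (hF t).continuousAt
  obtain ⟨C, hC⟩ := ((isCompact_closedBall t 1).prod (isCompact_uIcc (a := (0 : ℝ)) (b := τ))
    ).exists_bound_of_continuousOn (f := fun p : ℝ × ℝ => k p.2 * (f p.1 - f (p.1 - p.2)))
    (by fun_prop)
  refine (intervalIntegral.hasDerivAt_integral_of_dominated_loc_of_deriv_le
    (F := fun t s => k s * (F t - F (t - s))) (F' := fun t s => k s * (f t - f (t - s)))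
    (bound := fun _ => C)
    (Metric.closedBall_mem_nhds t one_pos) ?_ ?_ ?_ ?_ ?_ ?_).2
  · refine Eventually.of_forall fun x => Continuous.aestronglyMeasurable (by fun_prop)
  · exact Continuous.intervalIntegrable (by fun_prop) _ _
  · exact Continuous.aestronglyMeasurable (by fun_prop)
  · exact Eventually.of_forall fun s hs x hx => hC (x, s) ⟨hx, uIoc_subset_uIcc hs⟩
  · simp
  · refine Eventually.of_forall fun s hs x hx => ?_
    exact ((hF x).sub ((hF (x - s)).comp_sub_const x s)).const_mul (k s)

lemma EO.bound_shift {z : ℝ → ℝ} {a : ℝ} (hz : EO z a) {τ : ℝ} (_hτ : 0 ≤ τ) :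
    ∃ C > 0, ∃ t0, ∀ t ≤ t0, ∀ s ∈ Icc 0 τ, |z (t - s)| ≤ C * Real.exp (a * t) := by
  obtain ⟨C, hC, t0, h⟩ := hz.bound
  refine ⟨C * Real.exp (|a| * τ), by positivity, t0, fun t ht s hs => ?_⟩
  refine (h (t - s) (by linarith [hs.1])).trans ?_
  rw [mul_assoc, ← Real.exp_add]
  gcongr
  have h1 := neg_abs_le a
  have h2 := abs_nonneg a
  have h3 := mul_le_mul_of_nonneg_left hs.2 h2
  have h4 := mul_le_mul_of_nonneg_right h1 hs.1
  linarith

lemma EO_integral {f : ℝ → ℝ → ℝ} {a C t0 τ : ℝ} (hτ : 0 ≤ τ)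
    (h : ∀ t ≤ t0, ∀ s ∈ Icc 0 τ, |f t s| ≤ C * Real.exp (a * t)) :
    EO (fun t => ∫ s in (0 : ℝ)..τ, f t s) a := by
  refine EO.of_bound (C := C * τ) (t0 := t0) fun t ht => ?_
  have := intervalIntegral.norm_integral_le_of_norm_le_const (a := 0) (b := τ) (f := f t)
    (C := C * Real.exp (a * t)) (fun s hs => by
      rw [uIoc_of_le hτ] at hs
      exact h t ht s ⟨hs.1.le, hs.2⟩)
  rw [sub_zero, abs_of_nonneg hτ, Real.norm_eq_abs] at this
  linarith

lemma EO_conv {k z : ℝ → ℝ} {a τ k1 : ℝ} (hτ : 0 ≤ τ) (hk : ∀ s ∈ Icc 0 τ, |k s| ≤ k1)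
    (hz : EO z a) : EO (fun t => ∫ s in (0 : ℝ)..τ, k s * (z t - z (t - s))) a := by
  obtain ⟨C, hC, t0, h⟩ := hz.bound_shift hτ
  have hk1 : 0 ≤ k1 := (abs_nonneg _).trans (hk 0 ⟨le_rfl, hτ⟩)
  refine EO_integral (C := k1 * (2 * C)) (t0 := t0) hτ fun t ht s hs => ?_
  rw [abs_mul, mul_assoc]
  have h1 := h t ht 0 ⟨le_rfl, hτ⟩
  rw [sub_zero] at h1
  have h2 := h t ht s hs
  gcongr
  · exact hk s hs
  · exact (abs_sub _ _).trans (by linarith)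

lemma cs_integral {f : ℝ → ℝ} {τ : ℝ} (hτ : 0 ≤ τ) (hf : Continuous f) :
    (∫ s in (0 : ℝ)..τ, f s) ^ 2 ≤ τ * ∫ s in (0 : ℝ)..τ, f s ^ 2 := by
  set I := ∫ s in (0 : ℝ)..τ, f s with hI
  set J := ∫ s in (0 : ℝ)..τ, f s ^ 2 with hJ
  rcases hτ.eq_or_lt with h0 | h0
  · have : I = 0 := by rw [hI, ← h0]; simp
    rw [this, ← h0]; simp
  have h1 : 0 ≤ ∫ s in (0 : ℝ)..τ, (τ * f s - I) ^ 2 :=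
    intervalIntegral.integral_nonneg hτ fun s _ => sq_nonneg _
  have h2 : (∫ s in (0 : ℝ)..τ, (τ * f s - I) ^ 2) = τ ^ 2 * J - 2 * τ * I * I + τ * I ^ 2 := by
    have e : ∀ s, (τ * f s - I) ^ 2 = τ ^ 2 * f s ^ 2 - 2 * τ * I * f s + I ^ 2 := fun s => by ring
    simp only [e]
    rw [intervalIntegral.integral_add, intervalIntegral.integral_sub,
      intervalIntegral.integral_const_mul, intervalIntegral.integral_const_mul,
      intervalIntegral.integral_const]
    · simp [hI, hJ]
    all_goals exact Continuous.intervalIntegrable (by fun_prop) _ _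
  rw [h2] at h1
  have : 0 ≤ τ * (τ * J - I ^ 2) := by nlinarith
  have := nonneg_of_mul_nonneg_right this h0
  linarith

lemma exists_antideriv {f : ℝ → ℝ} (hc : Continuous f) :
    ∃ F : ℝ → ℝ, (∀ t, HasDerivAt F (f t) t) ∧
      ∀ t s, F t - F (t - s) = ∫ r in (0 : ℝ)..s, f (t - r) := by
  have hFd : ∀ t, HasDerivAt (fun t => ∫ x in (0 : ℝ)..t, f x) (f t) t := by
    intro t
    exact (intervalIntegral.integral_hasDerivAt_right (hc.intervalIntegrable 0 t)
      (hc.stronglyMeasurableAtFilter _ _) hc.continuousAt)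
  refine ⟨fun t => ∫ x in (0 : ℝ)..t, f x, hFd, fun t s => ?_⟩
  rw [intervalIntegral.integral_comp_sub_left, sub_zero]
  exact (intervalIntegral.integral_eq_sub_of_hasDerivAt (fun x _ => hFd x)
    (hc.intervalIntegrable _ _)).symm

set_option maxHeartbeats 1600000 in
lemma energy {k z z1 ρ Z : ℝ → ℝ} {τ k0 k1 σ : ℝ} (hτ : 0 ≤ τ) (hk : Continuous k)
    (hk0 : 0 < k0) (hkb : ∀ s ∈ Icc 0 τ, k0 ≤ k s ∧ k s ≤ k1)
    (hz : ∀ t, HasDerivAt z (z1 t) t)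
    (heq : ∀ t, z1 t = ρ t - ∫ s in (0 : ℝ)..τ, k s * (z t - z (t - s)))
    (hρ : EO ρ σ) (hσ : 0 < σ)
    (hZ : ∀ t s, Z t - Z (t - s) = ∫ r in (0 : ℝ)..s, z (t - r)) (hZc : Continuous Z)
    (hCf : EO (fun t => z t + ∫ s in (0 : ℝ)..τ, k s * (Z t - Z (t - s))) σ)
    (hzε : ∀ ε > 0, EO z (-ε)) : EO z σ := by
  have hzc : Continuous z := continuous_iff_continuousAt.2 fun t => (hz t).continuousAt
  have hk1 : 0 < k1 := lt_of_lt_of_le hk0 ((hkb 0 ⟨le_rfl, hτ⟩).1.trans (hkb 0 ⟨le_rfl, hτ⟩).2)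
  have ii : ∀ {f : ℝ → ℝ} (_ : Continuous f) (a b : ℝ),
    IntervalIntegrable f MeasureTheory.volume a b := fun hf a b => hf.intervalIntegrable a b
  obtain ⟨F, hFd, hF⟩ := exists_antideriv (f := fun t => z t ^ 2) (by fun_prop)
  have hFc : Continuous F := continuous_iff_continuousAt.2 fun t => (hFd t).continuousAt
  set Cf : ℝ → ℝ := fun t => z t + ∫ s in (0 : ℝ)..τ, k s * (Z t - Z (t - s)) with hCfdef
  set I2 : ℝ → ℝ := fun t => ∫ s in (0 : ℝ)..τ, (z t - z (t - s)) ^ 2 with hI2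
  set D : ℝ → ℝ := fun t => ∫ s in (0 : ℝ)..τ, k s * (z t - z (t - s)) ^ 2 with hD
  set V : ℝ → ℝ := fun t => 1 / 2 * z t ^ 2
    + 1 / 2 * ∫ s in (0 : ℝ)..τ, k s * (F t - F (t - s)) with hV
  have hI2D : ∀ t, k0 * I2 t ≤ D t := fun t => by
    rw [hI2, hD]
    simp only
    rw [← intervalIntegral.integral_const_mul]
    refine intervalIntegral.integral_mono_on hτ (ii (by fun_prop) _ _) (ii (by fun_prop) _ _)
      fun s hs => ?_
    exact mul_le_mul_of_nonneg_right (hkb s hs).1 (sq_nonneg _)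
  have hI20 : ∀ t, 0 ≤ I2 t := fun t =>
    intervalIntegral.integral_nonneg hτ fun s _ => sq_nonneg _
  have hF0 : ∀ t, ∀ s ∈ Icc 0 τ, 0 ≤ F t - F (t - s) := fun t s hs => by
    rw [hF]
    exact intervalIntegral.integral_nonneg hs.1 fun s _ => sq_nonneg _
  have hF1 : ∀ t, ∀ s ∈ Icc 0 τ, F t - F (t - s) ≤ 2 * τ * z t ^ 2 + 2 * I2 t := fun t s hs => by
    rw [hF]
    calc ∫ r in (0 : ℝ)..s, z (t - r) ^ 2 ≤ ∫ r in (0 : ℝ)..τ, z (t - r) ^ 2 := by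
          refine intervalIntegral.integral_mono_interval le_rfl hs.1 hs.2
            (Eventually.of_forall fun r => sq_nonneg _) (ii (by fun_prop) _ _)
      _ ≤ ∫ r in (0 : ℝ)..τ, (2 * z t ^ 2 + 2 * (z t - z (t - r)) ^ 2) := by
          refine intervalIntegral.integral_mono_on hτ (ii (by fun_prop) _ _) (ii (by fun_prop) _ _)
            fun r _ => ?_
          nlinarith [sq_nonneg (2 * z t - z (t - r))]
      _ = _ := by
          rw [intervalIntegral.integral_add (ii (by fun_prop) _ _) (ii (by fun_prop) _ _),
            intervalIntegral.integral_const_mul, intervalIntegral.integral_const_mul,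
            intervalIntegral.integral_const, sub_zero, smul_eq_mul]
          change 2 * (τ * z t ^ 2) + 2 * I2 t = _
          ring
  have hVlow : ∀ t, z t ^ 2 ≤ 2 * V t := fun t => by
    have : 0 ≤ ∫ s in (0 : ℝ)..τ, k s * (F t - F (t - s)) :=
      intervalIntegral.integral_nonneg hτ fun s hs =>
        mul_nonneg (hk0.le.trans (hkb s hs).1) (hF0 t s hs)
    simp only [hV]; linarith
  set B1 := 1 + k1 * τ ^ 2 + k1 * τ with hB1
  have hB10 : 0 < B1 := by positivity
  have hVup : ∀ t, V t ≤ B1 * (z t ^ 2 + I2 t) := fun t => by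
    have : (∫ s in (0 : ℝ)..τ, k s * (F t - F (t - s)))
        ≤ ∫ s in (0 : ℝ)..τ, k1 * (2 * τ * z t ^ 2 + 2 * I2 t) := by
      refine intervalIntegral.integral_mono_on hτ (ii (by fun_prop) _ _) (ii (by fun_prop) _ _)
        fun s hs => ?_
      exact mul_le_mul (hkb s hs).2 (hF1 t s hs) (hF0 t s hs) hk1.le
    rw [intervalIntegral.integral_const, sub_zero, smul_eq_mul] at this
    have h1 := hI20 t
    have h2 := sq_nonneg (z t)
    simp only [hV, hB1]
    have e1 : 0 ≤ k1 * τ ^ 2 * I2 t := by positivity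
    have e2 : 0 ≤ k1 * τ * z t ^ 2 := by positivity
    nlinarith
  set B3 := 2 * (k1 * τ) ^ 2 * τ with hB3
  have hB30 : 0 ≤ B3 := by positivity
  have hzsq : ∀ t, z t ^ 2 ≤ 2 * Cf t ^ 2 + B3 * I2 t := fun t => by
    set I1 := ∫ r in (0 : ℝ)..τ, |z t - z (t - r)| with hI1
    have hI1sq : I1 ^ 2 ≤ τ * I2 t := by
      have := cs_integral (f := fun r => |z t - z (t - r)|) hτ (by fun_prop)
      simpa only [sq_abs] using this
    have hI10 : 0 ≤ I1 := intervalIntegral.integral_nonneg hτ fun s _ => abs_nonneg _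
    have h1 : ∀ s ∈ Icc 0 τ, |s * z t - (Z t - Z (t - s))| ≤ I1 := fun s hs => by
      have e : s * z t - (Z t - Z (t - s)) = ∫ r in (0 : ℝ)..s, (z t - z (t - r)) := by
        rw [hZ, intervalIntegral.integral_sub (ii (by fun_prop) _ _) (ii (by fun_prop) _ _),
          intervalIntegral.integral_const]
        simp
      rw [e]
      refine (intervalIntegral.abs_integral_le_integral_abs hs.1).trans ?_
      exact intervalIntegral.integral_mono_interval le_rfl hs.1 hs.2
            (Eventually.of_forall fun r => abs_nonneg _) (ii (by fun_prop) _ _)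
    have h2 : |∫ s in (0 : ℝ)..τ, k s * (s * z t - (Z t - Z (t - s)))| ≤ k1 * I1 * τ := by
      have := intervalIntegral.norm_integral_le_of_norm_le_const (a := 0) (b := τ)
        (f := fun s => k s * (s * z t - (Z t - Z (t - s))))
        (C := k1 * I1) (fun s hs => by
          rw [uIoc_of_le hτ] at hs
          have hs' : s ∈ Icc 0 τ := ⟨hs.1.le, hs.2⟩
          rw [Real.norm_eq_abs, abs_mul, abs_of_pos (hk0.trans_le (hkb s hs').1)]
          exact mul_le_mul (hkb s hs').2 (h1 s hs') (abs_nonneg _) hk1.le)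
      rwa [sub_zero, abs_of_nonneg hτ, Real.norm_eq_abs] at this
    set Q := ∫ s in (0 : ℝ)..τ, k s * s with hQ
    have hQ0 : 0 ≤ Q := intervalIntegral.integral_nonneg hτ fun s hs =>
      mul_nonneg (hk0.le.trans (hkb s hs).1) hs.1
    have h3 : z t * (1 + Q) = Cf t + ∫ s in (0 : ℝ)..τ, k s * (s * z t - (Z t - Z (t - s))) := by
      have e : ∀ s, k s * (s * z t - (Z t - Z (t - s)))
        = z t * (k s * s) - k s * (Z t - Z (t - s)) := fun s => by ring
      simp only [e]
      rw [intervalIntegral.integral_sub (ii (by fun_prop) _ _) (ii (by fun_prop) _ _),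
        intervalIntegral.integral_const_mul]
      simp only [hCfdef]; ring
    have h4 : |z t| ≤ |Cf t| + k1 * I1 * τ := by
      have : |z t| * 1 ≤ |z t * (1 + Q)| := by
        rw [abs_mul, abs_of_nonneg (show 0 ≤ 1 + Q by linarith)]
        exact mul_le_mul_of_nonneg_left (by linarith) (abs_nonneg _)
      rw [mul_one, h3] at this
      exact this.trans ((abs_add_le _ _).trans (by linarith))
    have h5 : z t ^ 2 ≤ (|Cf t| + k1 * I1 * τ) ^ 2 := by
      rw [← sq_abs (z t)]
      exact pow_le_pow_left₀ (abs_nonneg _) h4 2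
    have h6 : (k1 * τ) ^ 2 * I1 ^ 2 ≤ (k1 * τ) ^ 2 * (τ * I2 t) :=
      mul_le_mul_of_nonneg_left hI1sq (sq_nonneg _)
    rw [hB3, ← sq_abs (Cf t)]
    nlinarith [sq_nonneg (|Cf t| - k1 * I1 * τ)]
  set N := B1 * (2 + (B3 + 1) / k0) with hN
  have hN0 : 0 < N := by positivity
  have hVN : ∀ t, V t ≤ N * (Cf t ^ 2 + D t) := fun t => by
    have h1 : I2 t ≤ D t / k0 := by rw [le_div_iff₀ hk0]; linarith [hI2D t]
    have hD0 : 0 ≤ D t := le_trans (mul_nonneg hk0.le (hI20 t)) (hI2D t)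
    calc V t ≤ B1 * (z t ^ 2 + I2 t) := hVup t
      _ ≤ B1 * (2 * Cf t ^ 2 + (B3 + 1) * (D t / k0)) := by
          have := mul_le_mul_of_nonneg_left h1 (show 0 ≤ B3 + 1 by linarith)
          have h2 := hzsq t
          refine mul_le_mul_of_nonneg_left ?_ hB10.le
          linarith
      _ ≤ N * (Cf t ^ 2 + D t) := by
          rw [hN, mul_assoc]
          refine mul_le_mul_of_nonneg_left ?_ hB10.le
          have e1 : 0 ≤ (B3 + 1) / k0 * Cf t ^ 2 := by positivity
          have e2 : (B3 + 1) * (D t / k0) = (B3 + 1) / k0 * D t := by ring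
          rw [e2]; linarith
  have hVd : ∀ t, HasDerivAt V (z t * ρ t - 1 / 2 * D t) t := fun t => by
    have h1 := ((hz t).pow 2).const_mul (1 / 2)
    have h2 := (conv_deriv (τ := τ) hk (show Continuous fun t => z t ^ 2 by fun_prop) hFd t
      ).const_mul (1 / 2)
    refine HasDerivAt.congr_deriv (h1.add h2) ?_
    have e : D t = 2 * (z t * ∫ s in (0 : ℝ)..τ, k s * (z t - z (t - s)))
        - ∫ s in (0 : ℝ)..τ, k s * (z t ^ 2 - z (t - s) ^ 2) := by
      rw [← intervalIntegral.integral_const_mul, ← intervalIntegral.integral_const_mul,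
        ← intervalIntegral.integral_sub (ii (by fun_prop) _ _) (ii (by fun_prop) _ _)]
      simp only [hD]
      congr 1; ext s; ring
    rw [e, heq t]
    simp only [Nat.cast_ofNat, Nat.add_one_sub_one, pow_one]
    ring
  set ε := 1 / (4 * N) with hε
  have hε0 : 0 < ε := by positivity
  obtain ⟨C1, hC1, t1, hb1⟩ := hρ.bound
  obtain ⟨C2, hC2, t2, hb2⟩ := hCf.bound
  set Q := 1 / 2 * C2 ^ 2 + 2 * N * C1 ^ 2 with hQ
  have hdiff : ∀ t ≤ min t1 t2, z t * ρ t - 1 / 2 * D t ≤ - ε * V t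
      + Q * Real.exp (2 * σ * t) := fun t ht => by
    have b1 := hb1 t (ht.trans (min_le_left _ _))
    have b2 := hb2 t (ht.trans (min_le_right _ _))
    set e := Real.exp (σ * t) with he
    have hee : Real.exp (2 * σ * t) = e ^ 2 := by
      rw [he, ← Real.exp_nat_mul]; congr 1; push_cast; ring
    have b1' : ρ t ^ 2 ≤ (C1 * e) ^ 2 := by
      rw [← sq_abs (ρ t)]; exact pow_le_pow_left₀ (abs_nonneg _) b1 2
    have b2' : Cf t ^ 2 ≤ (C2 * e) ^ 2 := by
      rw [← sq_abs (Cf t)]; exact pow_le_pow_left₀ (abs_nonneg _) b2 2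
    have h1 : 2 * ε * V t ≤ 1 / 2 * (Cf t ^ 2 + D t) := by
      have := mul_le_mul_of_nonneg_left (hVN t) (show 0 ≤ 2 * ε by positivity)
      refine this.trans (le_of_eq ?_)
      rw [hε]; field_simp; ring
    have h2 : z t * ρ t ≤ ε * V t + 2 * N * ρ t ^ 2 := by
      have h3 := mul_le_mul_of_nonneg_left (hVlow t) hε0.le
      have h4 : ε * N = 1 / 4 := by rw [hε]; field_simp
      have h5 : 0 ≤ ε / 2 * (z t - 4 * N * ρ t) ^ 2 := by positivity
      have h6 : ε / 2 * (z t - 4 * N * ρ t) ^ 2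
        = ε / 2 * z t ^ 2 - z t * ρ t + 2 * N * ρ t ^ 2 := by
        linear_combination (-4 * z t * ρ t + 8 * N * ρ t ^ 2) * h4
      linarith
    have h7 := mul_le_mul_of_nonneg_left b1' (show 0 ≤ 2 * N by positivity)
    rw [hee, hQ]
    nlinarith
  have hVE : EO V (-(ε / 2)) := by
    obtain ⟨C, hC, t0, hb⟩ := (hzε (ε / 4) (by positivity)).bound_shift hτ
    refine EO.of_bound (C := B1 * (C ^ 2 + (2 * C) ^ 2 * τ)) (t0 := t0) fun t ht => ?_
    set e := Real.exp (-(ε / 4) * t) with he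
    have hee : Real.exp (-(ε / 2) * t) = e ^ 2 := by
      rw [he, ← Real.exp_nat_mul]; congr 1; push_cast; ring
    have hV0 : 0 ≤ V t := by linarith [hVlow t, sq_nonneg (z t)]
    rw [abs_of_nonneg hV0, hee]
    refine (hVup t).trans ?_
    have b0 := hb t ht 0 ⟨le_rfl, hτ⟩
    rw [sub_zero] at b0
    have b1 : z t ^ 2 ≤ (C * e) ^ 2 := by
      rw [← sq_abs (z t)]; exact pow_le_pow_left₀ (abs_nonneg _) b0 2
    have b2 : I2 t ≤ (2 * C * e) ^ 2 * τ := by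
      calc I2 t ≤ ∫ s in (0 : ℝ)..τ, (2 * C * e) ^ 2 := by
            refine intervalIntegral.integral_mono_on hτ (ii (by fun_prop) _ _)
              (ii (by fun_prop) _ _) fun s hs => ?_
            rw [← sq_abs (z t - _)]
            refine pow_le_pow_left₀ (abs_nonneg _) ((abs_sub _ _).trans ?_) 2
            linarith [hb t ht s hs]
        _ = _ := by rw [intervalIntegral.integral_const, sub_zero, smul_eq_mul]; ring
    calc B1 * (z t ^ 2 + I2 t) ≤ B1 * ((C * e) ^ 2 + (2 * C * e) ^ 2 * τ) := by gcongr
      _ = _ := by ring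
  set L := Q / (2 * σ + ε) with hL
  have hQ0 : 0 ≤ Q := by positivity
  have hL0 : 0 ≤ L := by positivity
  have hH := nonneg_of_deriv (H := fun t => L * Real.exp ((2 * σ + ε) * t)
      - Real.exp (ε * t) * V t) (t0 := min t1 t2)
      (h := fun t => Real.exp (ε * t) *
        (Q * Real.exp (2 * σ * t) - ε * V t - (z t * ρ t - 1 / 2 * D t)))
    (fun t => by
      have d : ∀ a, HasDerivAt (fun t => Real.exp (a * t)) (a * Real.exp (a * t)) t := fun a => by
        have := hasDerivAt_expneg (-a) t
        simpa using this
      refine HasDerivAt.congr_deriv (((d (2 * σ + ε)).const_mul L).sub ((d ε).mul (hVd t))) ?_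
      have e1 : Real.exp ((2 * σ + ε) * t) = Real.exp (ε * t) * Real.exp (2 * σ * t) := by
        rw [← Real.exp_add]; ring_nf
      have e2 : L * (2 * σ + ε) = Q := by rw [hL]; field_simp
      rw [e1]
      linear_combination (Real.exp (ε * t) * Real.exp (2 * σ * t)) * e2)
    (fun t ht => mul_nonneg (Real.exp_pos _).le (by linarith [hdiff t ht]))
    (by
      have h1 := ((EO.exp (2 * σ + ε)).const_mul L).tendsto (by positivity)
      have h2 := ((EO.exp ε).mul hVE).tendsto (by linarith)
      have := h1.sub h2
      rwa [sub_zero] at this)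
  refine EO.of_bound (C := Real.sqrt (2 * L)) (t0 := min t1 t2) fun t ht => ?_
  have h1 := hH t ht
  have e1 : Real.exp ((2 * σ + ε) * t) = Real.exp (ε * t) * (Real.exp (σ * t)) ^ 2 := by
    rw [← Real.exp_nat_mul, ← Real.exp_add]; congr 1; push_cast; ring
  rw [e1] at h1
  have h2 : 0 ≤ Real.exp (ε * t) * (L * Real.exp (σ * t) ^ 2 - V t) := by linarith
  have h3 := nonneg_of_mul_nonneg_right h2 (Real.exp_pos _)
  apply abs_le_of_sq_le_sq _ (by positivity)
  rw [mul_pow, Real.sq_sqrt (by positivity)]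
  linarith [hVlow t]

lemma key_lemma {k z z1 ρ : ℝ → ℝ} {τ k0 k1 σ : ℝ} (hτ : 0 ≤ τ) (hk : Continuous k)
    (hk0 : 0 < k0) (hkb : ∀ s ∈ Icc 0 τ, k0 ≤ k s ∧ k s ≤ k1)
    (hz : ∀ t, HasDerivAt z (z1 t) t) (hρc : Continuous ρ)
    (heq : ∀ t, z1 t = ρ t - ∫ s in (0 : ℝ)..τ, k s * (z t - z (t - s)))
    (hρ : EO ρ σ) (hσ : 0 < σ)
    (hzε : ∀ ε > 0, EO z (-ε)) : ∃ m, EO (fun t => z t - m) σ ∧ EO z1 σ := by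
  have hzc : Continuous z := continuous_iff_continuousAt.2 fun t => (hz t).continuousAt
  obtain ⟨Z, hZd, hZ⟩ := exists_antideriv hzc
  have hZc : Continuous Z := continuous_iff_continuousAt.2 fun t => (hZd t).continuousAt
  obtain ⟨Pf, hPd, hPE⟩ := hρ.antideriv hσ hρc
  have hCd : ∀ t, HasDerivAt (fun t => z t + ∫ s in (0 : ℝ)..τ, k s * (Z t - Z (t - s))) (ρ t) t :=
    fun t => by
      refine HasDerivAt.congr_deriv ((hz t).add (conv_deriv hk hzc hZd t)) ?_
      rw [heq t]; ring
  obtain ⟨M, hM⟩ : ∃ M, ∀ t, (z t + ∫ s in (0 : ℝ)..τ, k s * (Z t - Z (t - s))) - Pf t = M := by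
    refine ⟨_, fun t => is_const_of_deriv_eq_zero (f := fun t =>
      (z t + ∫ s in (0 : ℝ)..τ, k s * (Z t - Z (t - s))) - Pf t)
      (fun t => ((hCd t).sub (hPd t)).differentiableAt) (fun t => ?_) t 0⟩
    have := ((hCd t).sub (hPd t)).deriv
    rw [sub_self] at this
    exact this
  set Q := ∫ s in (0 : ℝ)..τ, k s * s with hQ
  have hQ0 : 0 ≤ Q := intervalIntegral.integral_nonneg hτ fun s hs =>
    mul_nonneg (hk0.le.trans (hkb s hs).1) hs.1
  set m := M / (1 + Q) with hm
  have hmM : m * (1 + Q) = M := by rw [hm]; field_simp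
  have hE : EO (fun t => z t - m) σ := by
    refine energy (k := k) (z1 := z1) (ρ := ρ) (Z := fun t => Z t - m * t) hτ hk hk0 hkb
      (fun t => (hz t).sub_const m) (fun t => ?_) hρ hσ (fun t s => ?_) (by fun_prop) ?_ ?_
    · rw [heq t]; simp
    · rw [intervalIntegral.integral_sub (Continuous.intervalIntegrable (by fun_prop) _ _)
        (Continuous.intervalIntegrable (by fun_prop) _ _), intervalIntegral.integral_const, ← hZ]
      simp; ring
    · refine hPE.congr' (fun t => ?_) rfl
      have e : ∀ s, k s * (Z t - m * t - (Z (t - s) - m * (t - s)))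
        = k s * (Z t - Z (t - s)) - m * (k s * s) := fun s => by ring
      simp only [e]
      rw [intervalIntegral.integral_sub (Continuous.intervalIntegrable (by fun_prop) _ _)
        (Continuous.intervalIntegrable (by fun_prop) _ _), intervalIntegral.integral_const_mul]
      linarith [hM t]
    · intro ε hε
      exact (hzε ε hε).sub ((EO.const m).mono (by linarith))
  refine ⟨m, hE, ?_⟩
  have h1 := EO_conv (k := k) (k1 := k1) hτ (fun s hs => by
    rw [abs_of_pos (hk0.trans_le (hkb s hs).1)]; exact (hkb s hs).2) hE
  refine (hρ.sub h1).congr' (fun t => ?_) rfl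
  rw [heq t]; simp

lemma hasDerivAt_exppos (a t : ℝ) :
    HasDerivAt (fun t => Real.exp (a * t)) (a * Real.exp (a * t)) t := by
  have := hasDerivAt_expneg (-a) t
  simpa using this

lemma EO_prim_neg {F f : ℝ → ℝ} {a : ℝ} (ha : 0 < a) (hF : ∀ t, HasDerivAt F (f t) t)
    (hf : EO f (-a)) : EO F (-a) := by
  obtain ⟨C, hC, t0, h⟩ := hf.bound
  have key : ∀ (G g : ℝ → ℝ), (∀ t, HasDerivAt G (g t) t) → (∀ t ≤ t0, |g t| ≤ C * Real.exp (-a * t)) →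
      ∀ t ≤ t0, G t ≤ |G t0| + C / a * Real.exp (-a * t) := by
    intro G g hG hg t ht
    have hd : ∀ t, HasDerivAt (fun t => G t - C / a * Real.exp (-a * t))
        (g t + C * Real.exp (-a * t)) t := fun t => by
      refine HasDerivAt.congr_deriv ((hG t).sub ((hasDerivAt_exppos (-a) t).const_mul (C / a))) ?_
      field_simp; ring
    have hm : MonotoneOn (fun t => G t - C / a * Real.exp (-a * t)) (Iic t0) := by
      apply monotoneOn_of_deriv_nonneg (convex_Iic t0)
      · exact fun x _ => (hd x).continuousAt.continuousWithinAt
      · exact fun x _ => (hd x).differentiableAt.differentiableWithinAt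
      · intro x hx
        rw [(hd x).deriv]
        have := abs_le.1 (hg x (mem_Iic.1 (interior_subset hx)))
        linarith
    have h1 := hm ht (mem_Iic.2 le_rfl) ht
    simp only at h1
    have h2 := le_abs_self (G t0)
    have h3 : 0 ≤ C / a * Real.exp (-a * t0) := by positivity
    linarith
  have h1 := key F f hF h
  have h2 := key (fun t => -F t) (fun t => - f t) (fun t => (hF t).neg) (fun t ht => by
    rw [abs_neg]; exact h t ht)
  have h3 : EO (fun t => |F t0| + C / a * Real.exp (-a * t)) (-a) :=
    ((EO.const |F t0|).mono (by linarith)).add ((EO.exp (-a)).const_mul (C / a))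
  obtain ⟨C', hC', t1, h4⟩ := h3.bound
  refine EO.of_bound (C := C') (t0 := min t0 t1) fun t ht => ?_
  have ht0 := ht.trans (min_le_left _ _)
  have a1 := h1 t ht0
  have a2 := h2 t ht0
  have a3 := (le_abs_self _).trans (h4 t (ht.trans (min_le_right _ _)))
  rw [abs_neg] at a2
  rw [abs_le]; constructor <;> linarith

lemma EO_prim_pos {F f : ℝ → ℝ} {a : ℝ} (ha : 0 < a) (hF : ∀ t, HasDerivAt F (f t) t)
    (hfc : Continuous f) (hf : EO f a) : ∃ M, EO (fun t => F t - M) a := by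
  obtain ⟨Q, hQd, hQE⟩ := hf.antideriv ha hfc
  refine ⟨F 0 - Q 0, hQE.congr' (fun t => ?_) rfl⟩
  have := is_const_of_deriv_eq_zero (f := fun t => F t - Q t)
      (fun t => ((hF t).sub (hQd t)).differentiableAt) (fun t => by
        have := ((hF t).sub (hQd t)).deriv
        rw [sub_self] at this
        exact this) t 0
  linarith

lemma EO_id {ε : ℝ} (hε : 0 < ε) : EO (fun t => t) (-ε) := by
  refine EO.of_bound (C := 1 / ε) (t0 := 0) fun t ht => ?_
  rw [abs_of_nonpos ht]
  have := Real.add_one_le_exp (-ε * t)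
  rw [div_mul_eq_mul_div, le_div_iff₀ hε]
  linarith

section
variable {φ φ1 φ2 R : ℝ → ℝ} {b c τ l1 l2 : ℝ}

def wF (φ : ℝ → ℝ) (l : ℝ) : ℝ → ℝ := fun t => Real.exp (-(l * t)) * φ t
def w1F (φ φ1 : ℝ → ℝ) (l : ℝ) : ℝ → ℝ := fun t => Real.exp (-(l * t)) * (φ1 t - l * φ t)
def kF (b τ l1 l2 : ℝ) : ℝ → ℝ := fun s => b * Real.exp (-(l1 * τ)) * Real.exp ((l1 - l2) * s)
def YF (φ φ1 : ℝ → ℝ) (b τ l1 l2 : ℝ) : ℝ → ℝ := fun t => w1F φ φ1 l2 t +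
  ∫ s in (0 : ℝ)..τ, kF b τ l1 l2 s * (wF φ l2 t - wF φ l2 (t - s))

lemma EO_expneg (l : ℝ) : EO (fun t => Real.exp (-(l * t))) (-l) :=
  (EO.exp (-l)).congr' (fun t => by ring_nf) rfl

lemma kF_cont : Continuous (kF b τ l1 l2) := by unfold kF; fun_prop

lemma kF_bd (P : Prof φ φ1 φ2 R b c τ) (h12 : l2 ≤ l1) : ∀ s ∈ Icc 0 τ,
    b * Real.exp (-(l1 * τ)) ≤ kF b τ l1 l2 s ∧
    kF b τ l1 l2 s ≤ b * Real.exp (-(l1 * τ)) * Real.exp ((l1 - l2) * τ) := by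
  intro s hs
  have hb := P.hb
  have h0 : 0 < b * Real.exp (-(l1 * τ)) := by positivity
  have hd : 0 ≤ l1 - l2 := by linarith
  constructor
  · unfold kF
    have : 1 ≤ Real.exp ((l1 - l2) * s) := Real.one_le_exp (mul_nonneg hd hs.1)
    nlinarith
  · unfold kF
    have := hs.2
    gcongr

lemma wF_d (P : Prof φ φ1 φ2 R b c τ) (l t : ℝ) : HasDerivAt (wF φ l) (w1F φ φ1 l t) t := by
  refine HasDerivAt.congr_deriv ((hasDerivAt_expneg l t).mul (P.d1 t)) ?_
  simp only [w1F]; ring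

lemma w1F_d (P : Prof φ φ1 φ2 R b c τ) (l t : ℝ) : HasDerivAt (w1F φ φ1 l)
    (Real.exp (-(l * t)) * (φ2 t - 2 * l * φ1 t + l ^ 2 * φ t)) t := by
  refine HasDerivAt.congr_deriv ((hasDerivAt_expneg l t).mul
    ((P.d2 t).sub ((P.d1 t).const_mul l))) ?_
  ring

lemma YF_d (P : Prof φ φ1 φ2 R b c τ) (h1 : chiF b c τ l1 = 0)
    (hκ : ∫ s in (0 : ℝ)..τ, kF b τ l1 l2 s = l1 + l2 - c) (t : ℝ) :
    HasDerivAt (YF φ φ1 b τ l1 l2)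
      ((l1 - l2) * YF φ φ1 b τ l1 l2 t + Real.exp (-(l2 * t)) * R t) t := by
  have hkc : Continuous (kF b τ l1 l2) := kF_cont
  have hwc : Continuous (wF φ l2) :=
    continuous_iff_continuousAt.2 fun t => (wF_d P l2 t).continuousAt
  have hw1c : Continuous (w1F φ φ1 l2) :=
    continuous_iff_continuousAt.2 fun t => (w1F_d P l2 t).continuousAt
  have ii : ∀ {f : ℝ → ℝ} (_ : Continuous f) (a b : ℝ),
    IntervalIntegrable f MeasureTheory.volume a b := fun hf a b => hf.intervalIntegrable a b
  refine HasDerivAt.congr_deriv ((w1F_d P l2 t).add (conv_deriv hkc hw1c (wF_d P l2) t)) ?_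
  have split : ∀ f : ℝ → ℝ, Continuous f →
      (∫ s in (0 : ℝ)..τ, kF b τ l1 l2 s * (f t - f (t - s)))
      = (l1 + l2 - c) * f t - ∫ s in (0 : ℝ)..τ, kF b τ l1 l2 s * f (t - s) := fun f hf => by
    simp only [mul_sub]
    rw [intervalIntegral.integral_sub (ii (by fun_prop) _ _) (ii (by fun_prop) _ _),
      intervalIntegral.integral_mul_const, hκ]
  have ftc : (∫ s in (0 : ℝ)..τ, ((l1 - l2) * (kF b τ l1 l2 s * wF φ l2 (t - s))
      - kF b τ l1 l2 s * w1F φ φ1 l2 (t - s)))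
      = kF b τ l1 l2 τ * wF φ l2 (t - τ) - kF b τ l1 l2 0 * wF φ l2 (t - 0) := by
    refine intervalIntegral.integral_eq_sub_of_hasDerivAt
      (f := fun s => kF b τ l1 l2 s * wF φ l2 (t - s)) (fun s _ => ?_) (ii (by fun_prop) _ _)
    have hkd : HasDerivAt (kF b τ l1 l2) ((l1 - l2) * kF b τ l1 l2 s) s := by
      refine HasDerivAt.congr_deriv ((hasDerivAt_exppos (l1 - l2) s).const_mul
        (b * Real.exp (-(l1 * τ)))) ?_
      simp only [kF]; ring
    refine HasDerivAt.congr_deriv (hkd.mul ((wF_d P l2 (t - s)).comp_const_sub t s)) ?_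
    ring
  rw [intervalIntegral.integral_sub (ii (by fun_prop) _ _) (ii (by fun_prop) _ _),
    intervalIntegral.integral_const_mul] at ftc
  unfold YF
  rw [split _ hwc, split _ hw1c]
  have he : Real.exp (-(l1 * τ)) * Real.exp ((l1 - l2) * τ) * Real.exp (-(l2 * (t - τ)))
      = Real.exp (-(l2 * t)) := by
    rw [← Real.exp_add, ← Real.exp_add]; ring_nf
  have e1 : kF b τ l1 l2 τ * wF φ l2 (t - τ) = b * Real.exp (-(l2 * t)) * φ (t - τ) := by
    simp only [kF, wF]; rw [← he]; ring
  have e2 : kF b τ l1 l2 0 * wF φ l2 (t - 0)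
      = -(l1 ^ 2 - c * l1 - 1) * (Real.exp (-(l2 * t)) * φ t) := by
    simp only [kF, wF, chiF, sub_zero, mul_zero, Real.exp_zero, mul_one] at h1 ⊢
    linear_combination (Real.exp (-(l2 * t)) * φ t) * h1
  rw [e1, e2] at ftc
  rw [← P.eq t]
  simp only [wF, w1F] at ftc ⊢
  linear_combination ftc

lemma UF_d (P : Prof φ φ1 φ2 R b c τ) (h1 : chiF b c τ l1 = 0)
    (hκ : ∫ s in (0 : ℝ)..τ, kF b τ l1 l2 s = l1 + l2 - c) (t : ℝ) :
    HasDerivAt (fun t => Real.exp (-((l1 - l2) * t)) * YF φ φ1 b τ l1 l2 t)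
      (Real.exp (-(l1 * t)) * R t) t := by
  refine HasDerivAt.congr_deriv ((hasDerivAt_expneg (l1 - l2) t).mul (YF_d P h1 hκ t)) ?_
  have : Real.exp (-(l1 * t)) = Real.exp (-((l1 - l2) * t)) * Real.exp (-(l2 * t)) := by
    rw [← Real.exp_add]; ring_nf
  rw [this]; ring

lemma wF_EO (P : Prof φ φ1 φ2 R b c τ) (l a : ℝ) (h : EO φ (l + a)) : EO (wF φ l) a :=
  ((EO_expneg l).mul h).congr' (fun _ => rfl) (by ring)

lemma exp_wF (l t : ℝ) : Real.exp (l * t) * wF φ l t = φ t := by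
  simp only [wF]; rw [← mul_assoc, ← Real.exp_add]; simp

lemma exp_w1F (l t : ℝ) : Real.exp (l * t) * (w1F φ φ1 l t + l * wF φ l t) = φ1 t := by
  have : Real.exp (l * t) * Real.exp (-(l * t)) = 1 := by rw [← Real.exp_add]; simp
  simp only [wF, w1F]
  linear_combination φ1 t * this

lemma exp_sub' (l1 l2 t : ℝ) :
    Real.exp (l2 * t) * Real.exp ((l1 - l2) * t) = Real.exp (l1 * t) := by
  rw [← Real.exp_add]; ring_nf

lemma caseA (P : Prof φ φ1 φ2 R b c τ) (h1 : chiF b c τ l1 = 0) (h12 : l2 < l1)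
    (hκ : ∫ s in (0 : ℝ)..τ, kF b τ l1 l2 s = l1 + l2 - c)
    (hφ : ∀ a < l2, EO φ a) {σ : ℝ} (hσ : 0 < σ) (hσd : σ < l1 - l2) (hR : EO R (l2 + σ)) :
    ∃ m, EO (fun t => φ t - m * Real.exp (l2 * t)) (l2 + σ) ∧
      EO (fun t => φ1 t - m * l2 * Real.exp (l2 * t)) (l2 + σ) := by
  have hU := EO_prim_neg (a := l1 - l2 - σ) (by linarith) (UF_d P h1 hκ)
    (((EO_expneg l1).mul hR).congr' (fun _ => rfl) (by ring))
  have hY : EO (YF φ φ1 b τ l1 l2) σ := by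
    refine ((EO.exp (l1 - l2)).mul hU).congr' (fun t => ?_) (by ring)
    rw [← mul_assoc, ← Real.exp_add]; simp
  have hYc : Continuous (YF φ φ1 b τ l1 l2) :=
    continuous_iff_continuousAt.2 fun t => (YF_d P h1 hκ t).continuousAt
  have hb := P.hb
  obtain ⟨m, hm, hm1⟩ := key_lemma P.hτ kF_cont (by positivity) (kF_bd P h12.le) (wF_d P l2) hYc
    (fun t => by simp only [YF]; ring) hY hσ
    (fun ε hε => wF_EO P l2 _ (hφ _ (by linarith)))
  refine ⟨m, ((EO.exp l2).mul hm).congr' (fun t => ?_) rfl,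
    ((EO.exp l2).mul (hm1.add (hm.const_mul l2))).congr' (fun t => ?_) rfl⟩
  · rw [← exp_wF (φ := φ) l2 t]; ring
  · rw [← exp_w1F (φ := φ) (φ1 := φ1) l2 t]; ring

lemma YF_lim (P : Prof φ φ1 φ2 R b c τ) (h1 : chiF b c τ l1 = 0)
    (hκ : ∫ s in (0 : ℝ)..τ, kF b τ l1 l2 s = l1 + l2 - c)
    {σ : ℝ} (hσ : 0 < σ) (hR : EO R (l1 + σ)) :
    ∃ M, EO (fun t => YF φ φ1 b τ l1 l2 t - M * Real.exp ((l1 - l2) * t)) (l1 - l2 + σ) := by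
  obtain ⟨M, hM⟩ := EO_prim_pos hσ (UF_d P h1 hκ)
    (by have := P.contR; fun_prop)
    (((EO_expneg l1).mul hR).congr' (fun _ => rfl) (by ring))
  refine ⟨M, ((EO.exp (l1 - l2)).mul hM).congr' (fun t => ?_) (by ring)⟩
  rw [mul_sub, ← mul_assoc, ← Real.exp_add]; simp; ring

lemma caseB (P : Prof φ φ1 φ2 R b c τ) (h1 : chiF b c τ l1 = 0) (h12 : l2 < l1)
    (hκ : ∫ s in (0 : ℝ)..τ, kF b τ l1 l2 s = l1 + l2 - c)
    (hφ : ∀ a < l1, EO φ a) {σ : ℝ} (hσ : 0 < σ) (hR : EO R (l1 + σ)) :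
    ∃ m, EO (fun t => φ t - m * Real.exp (l1 * t)) (l1 + σ) ∧
      EO (fun t => φ1 t - m * l1 * Real.exp (l1 * t)) (l1 + σ) := by
  obtain ⟨E, hE⟩ := YF_lim P h1 hκ hσ hR
  have hYc : Continuous (YF φ φ1 b τ l1 l2) :=
    continuous_iff_continuousAt.2 fun t => (YF_d P h1 hκ t).continuousAt
  have hwc : Continuous (wF φ l2) :=
    continuous_iff_continuousAt.2 fun t => (wF_d P l2 t).continuousAt
  have hb := P.hb
  have hkc : Continuous (kF b τ l1 l2) := kF_cont
  set d := l1 - l2 with hd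
  have hd0 : 0 < d := by linarith
  set Q := ∫ s in (0 : ℝ)..τ, kF b τ l1 l2 s * (1 - Real.exp (-(d * s))) with hQ
  have hQ0 : 0 ≤ Q := intervalIntegral.integral_nonneg P.hτ fun s hs => by
    refine mul_nonneg (le_trans (by positivity) (kF_bd P h12.le s hs).1) ?_
    have := Real.exp_le_one_iff.2 (show -(d * s) ≤ 0 by have := mul_nonneg hd0.le hs.1; linarith)
    linarith
  set M := E / (d + Q) with hM
  have hME : M * (d + Q) = E := by
    have : d + Q ≠ 0 := by linarith
    rw [hM]; field_simp
  have hwE : EO (wF φ l2) (d / 2) := wF_EO P l2 _ (hφ _ (by linarith))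
  have hzE : EO (fun t => wF φ l2 t - M * Real.exp (d * t)) (d / 2) :=
    hwE.sub (((EO.exp d).mono (by linarith)).const_mul M)
  obtain ⟨m, hm, hm1⟩ := key_lemma (z := fun t => wF φ l2 t - M * Real.exp (d * t))
    P.hτ kF_cont (by positivity) (kF_bd P h12.le)
    (fun t => (wF_d P l2 t).sub ((hasDerivAt_exppos d t).const_mul M))
    (ρ := fun t => YF φ φ1 b τ l1 l2 t - E * Real.exp (d * t)) (by fun_prop)
    (fun t => by
      have e : ∀ s, kF b τ l1 l2 s * (wF φ l2 t - M * Real.exp (d * t)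
          - (wF φ l2 (t - s) - M * Real.exp (d * (t - s))))
          = kF b τ l1 l2 s * (wF φ l2 t - wF φ l2 (t - s))
            - M * Real.exp (d * t) * (kF b τ l1 l2 s * (1 - Real.exp (-(d * s)))) := fun s => by
        rw [show d * (t - s) = d * t + -(d * s) by ring, Real.exp_add]; ring
      simp only [e]
      rw [intervalIntegral.integral_sub (Continuous.intervalIntegrable (by fun_prop) _ _)
        (Continuous.intervalIntegrable (by fun_prop) _ _), intervalIntegral.integral_const_mul]
      simp only [YF]
      linear_combination (-Real.exp (d * t)) * hME) hE (by linarith)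
    (fun ε hε => hzE.mono (by linarith))
  have hm0 : m = 0 := by
    have t1 := hm.tendsto (by linarith)
    have t2 := (hzE.tendsto (by linarith)).sub_const m
    have := tendsto_nhds_unique t1 t2
    linarith
  subst hm0
  refine ⟨M, ((EO.exp l2).mul hm).congr' (fun t => ?_) (by ring),
    ((EO.exp l2).mul (hm1.add (hm.const_mul l2))).congr' (fun t => ?_) (by ring)⟩
  · rw [← exp_wF (φ := φ) l2 t, ← exp_sub' l1 l2 t]; ring
  · rw [← exp_w1F (φ := φ) (φ1 := φ1) l2 t, ← exp_sub' l1 l2 t]; ring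

lemma caseC {l : ℝ} (P : Prof φ φ1 φ2 R b c τ) (h1 : chiF b c τ l = 0)
    (hκ : ∫ s in (0 : ℝ)..τ, kF b τ l l s = l + l - c)
    (hφ : ∀ a < l, EO φ a) {σ : ℝ} (hσ : 0 < σ) (hR : EO R (l + σ)) :
    ∃ m ≤ 0, EO (fun t => φ t - m * t * Real.exp (l * t)) l ∧
      EO (fun t => φ1 t - l * (m * t) * Real.exp (l * t)) l := by
  obtain ⟨E, hE⟩ := YF_lim P h1 hκ hσ hR
  have hE : EO (fun t => YF φ φ1 b τ l l t - E) σ := hE.congr' (fun t => by simp) (by ring)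
  have hYc : Continuous (YF φ φ1 b τ l l) :=
    continuous_iff_continuousAt.2 fun t => (YF_d P h1 hκ t).continuousAt
  have hwc : Continuous (wF φ l) :=
    continuous_iff_continuousAt.2 fun t => (wF_d P l t).continuousAt
  have hb := P.hb
  have hkc : Continuous (kF b τ l l) := kF_cont
  set Q := ∫ s in (0 : ℝ)..τ, kF b τ l l s * s with hQ
  have hQ0 : 0 ≤ Q := intervalIntegral.integral_nonneg P.hτ fun s hs => by
    exact mul_nonneg (le_trans (by positivity) (kF_bd P le_rfl s hs).1) hs.1
  set M := E / (1 + Q) with hM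
  have hME : M * (1 + Q) = E := by
    have : 1 + Q ≠ 0 := by linarith
    rw [hM]; field_simp
  obtain ⟨m, hm, hm1⟩ := key_lemma (k := kF b τ l l) (z := fun t => wF φ l t - M * t)
    P.hτ kF_cont (by positivity) (kF_bd P le_rfl)
    (fun t => (wF_d P l t).sub ((hasDerivAt_id t).const_mul M))
    (ρ := fun t => YF φ φ1 b τ l l t - E) (by fun_prop)
    (fun t => by
      have e : ∀ s, kF b τ l l s * (wF φ l t - M * t
          - (wF φ l (t - s) - M * (t - s)))
          = kF b τ l l s * (wF φ l t - wF φ l (t - s))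
            - M * (kF b τ l l s * s) := fun s => by ring
      simp only [e]
      rw [intervalIntegral.integral_sub (Continuous.intervalIntegrable (by fun_prop) _ _)
        (Continuous.intervalIntegrable (by fun_prop) _ _), intervalIntegral.integral_const_mul]
      simp only [YF]
      linear_combination (-1) * hME) hE (by linarith)
    (fun ε hε => (wF_EO P l _ (hφ _ (by linarith))).sub ((EO_id hε).const_mul M))
  have hz0 : EO (fun t => wF φ l t - M * t) 0 :=
    ((hm.mono hσ.le).add (EO.const m)).congr' (fun t => by ring) rfl
  have hz1 : EO (fun t => w1F φ φ1 l t) 0 :=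
    ((hm1.mono hσ.le).add (EO.const M)).congr' (fun t => by ring) rfl
  refine ⟨M, ?_, ((EO.exp l).mul hz0).congr' (fun t => ?_) (by ring),
    ((EO.exp l).mul (hz1.add (hz0.const_mul l))).congr' (fun t => ?_) (by ring)⟩
  · by_contra hcon
    have hM0 : 0 < M := not_le.1 hcon
    obtain ⟨C, hC, t0, hb⟩ := hz0.bound
    set t := min t0 (-(C / M)) with ht
    have h3 := hb t (min_le_left _ _)
    simp only [zero_mul, Real.exp_zero, mul_one] at h3
    have h4 := (abs_le.1 h3).2
    have h5 : 0 < wF φ l t := mul_pos (Real.exp_pos _) (P.pos t)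
    have h6 : t ≤ -(C / M) := min_le_right _ _
    have h7 := mul_le_mul_of_nonneg_left h6 hM0.le
    have h8 : M * -(C / M) = -C := by field_simp
    linarith
  · rw [← exp_wF (φ := φ) l t]; ring
  · rw [← exp_w1F (φ := φ) (φ1 := φ1) l t]; ring

lemma final_super (P : Prof φ φ1 φ2 R b c τ) {l σ m : ℝ} (hl : 0 < l) (hσ : 0 < σ)
    (hn : ∀ a > l, ¬ EO φ a)
    (h0 : EO (fun t => φ t - m * Real.exp (l * t)) (l + σ))
    (h1 : EO (fun t => φ1 t - m * l * Real.exp (l * t)) (l + σ)) :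
    ∃ s0, EO (fun t => φ (t + s0) - Real.exp (l * t)) (l + σ) ∧
      EO (fun t => φ1 (t + s0) - l * Real.exp (l * t)) (l + σ) := by
  have hm : 0 < m := by
    rcases lt_trichotomy m 0 with hm | hm | hm
    · exfalso
      have : EO (fun t => wF φ l t - m) σ := ((EO_expneg l).mul h0).congr' (fun t => by
        simp only [wF]
        have : Real.exp (l * t) * Real.exp (-(l * t)) = 1 := by rw [← Real.exp_add]; simp
        linear_combination m * this) (by ring)
      have := (this.tendsto hσ).add_const m
      simp only [sub_add_cancel, zero_add] at this
      have := ge_of_tendsto this (Eventually.of_forall fun t =>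
        (mul_pos (Real.exp_pos _) (P.pos t)).le)
      linarith
    · exfalso
      subst hm
      exact hn (l + σ) (by linarith) (h0.congr' (fun t => by ring) rfl)
    · exact hm
  set s0 := -(Real.log m / l) with hs0
  have hms : m * Real.exp (l * s0) = 1 := by
    have : l * s0 = - Real.log m := by rw [hs0]; field_simp
    rw [this, Real.exp_neg, Real.exp_log hm]; field_simp
  refine ⟨s0, (h0.shift (-s0)).congr' (fun t => ?_) rfl, (h1.shift (-s0)).congr' (fun t => ?_) rfl⟩
  · rw [sub_neg_eq_add, mul_add, Real.exp_add]
    linear_combination Real.exp (l * t) * hms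
  · rw [sub_neg_eq_add, mul_add, Real.exp_add]
    linear_combination l * Real.exp (l * t) * hms
end

lemma kF_int_ne {b c τ l1 l2 : ℝ} (h12 : l2 < l1) (h1 : chiF b c τ l1 = 0) (h2 : chiF b c τ l2 = 0) :
    ∫ s in (0 : ℝ)..τ, kF b τ l1 l2 s = l1 + l2 - c := by
  have hd : l1 - l2 ≠ 0 := by linarith
  have hc : Continuous (kF b τ l1 l2) := kF_cont
  have := intervalIntegral.integral_eq_sub_of_hasDerivAt
    (f := fun s => b * Real.exp (-(l1 * τ)) / (l1 - l2) * Real.exp ((l1 - l2) * s))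
    (f' := kF b τ l1 l2) (a := 0) (b := τ)
    (fun s _ => HasDerivAt.congr_deriv ((hasDerivAt_exppos (l1 - l2) s).const_mul _) (by
      simp only [kF]; field_simp)) (hc.intervalIntegrable _ _)
  rw [this]
  have e : Real.exp (-(l1 * τ)) * Real.exp ((l1 - l2) * τ) = Real.exp (-(l2 * τ)) := by
    rw [← Real.exp_add]; ring_nf
  simp only [chiF] at h1 h2
  simp only [mul_zero, Real.exp_zero]
  rw [mul_comm (l1 - l2) τ] at e
  field_simp
  linear_combination b * e + h2 - h1

lemma kF_int_eq {b c τ l : ℝ} (h2 : 2 * l - c - b * τ * Real.exp (-(l * τ)) = 0) :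
    ∫ s in (0 : ℝ)..τ, kF b τ l l s = l + l - c := by
  simp only [kF, sub_self, zero_mul, Real.exp_zero, intervalIntegral.integral_const, smul_eq_mul]
  linear_combination -h2

lemma chiF_unique {b c τ l z : ℝ} (hb : 0 < b) (h1 : chiF b c τ l = 0)
    (h2 : 2 * l - c - b * τ * Real.exp (-(l * τ)) = 0) (hz : chiF b c τ z = 0) : z = l := by
  simp only [chiF] at *
  have e : Real.exp (-(z * τ)) = Real.exp (-(l * τ)) * Real.exp (-((z - l) * τ)) := by
    rw [← Real.exp_add]; ring_nf
  have h3 := Real.add_one_le_exp (-((z - l) * τ))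
  have h4 := mul_nonneg (mul_nonneg hb.le (Real.exp_pos (-(l * τ))).le) (sub_nonneg.2 h3)
  rw [e] at hz
  have : (z - l) ^ 2 ≤ 0 := by
    have e2 : (z - l) ^ 2 = -(b * Real.exp (-(l * τ)) * (Real.exp (-((z - l) * τ)) - (-((z - l) * τ) + 1))) := by
      linear_combination hz - h1 - (z - l) * h2
    linarith
  have := pow_eq_zero_iff (two_ne_zero) |>.1 (le_antisymm this (sq_nonneg _))
  linarith

lemma holder_bound {g : ℝ → ℝ} {A δ γ : ℝ} (hg : Differentiable ℝ g) (hg0 : g 0 = 0) (hA : 0 < A)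
    (hγ : 0 < γ)
    (hH : ∀ u ∈ Icc 0 δ, |deriv g u - deriv g 0| ≤ A * u ^ γ) (u : ℝ) (hu : 0 < u) (huδ : u ≤ δ) :
    |deriv g 0 * u - g u| ≤ A * u ^ (1 + γ) := by
  obtain ⟨v, hv, he⟩ := exists_deriv_eq_slope g hu hg.continuous.continuousOn hg.differentiableOn
  rw [hg0, sub_zero, sub_zero, eq_div_iff hu.ne'] at he
  have h1 := hH v ⟨hv.1.le, hv.2.le.trans huδ⟩
  have h2 : v ^ γ ≤ u ^ γ := Real.rpow_le_rpow hv.1.le hv.2.le hγ.le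
  rw [← he, ← sub_mul, abs_mul, abs_of_pos hu, abs_sub_comm, add_comm, Real.rpow_add_one hu.ne']
  rw [← mul_assoc]
  exact mul_le_mul_of_nonneg_right (h1.trans (mul_le_mul_of_nonneg_left h2 hA.le)) hu.le

lemma R_decay {φ R : ℝ → ℝ} {A γ τ s t1 : ℝ} (hA : 0 < A) (hγ : 0 < γ) (hs : 0 < s)
    (hpos : ∀ t, 0 < φ t) (hR : ∀ t ≤ t1, |R t| ≤ A * φ (t - τ) ^ (1 + γ))
    (hφ : ∀ a < s, EO φ a) : EO R (s + γ * s / 2) := by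
  have h1γ : 0 < 1 + γ := by linarith
  set a := (s + γ * s / 2) / (1 + γ) with ha
  have haa : a * (1 + γ) = s + γ * s / 2 := by rw [ha]; field_simp
  have has : a < s := by
    rw [ha, div_lt_iff₀ h1γ]; have := mul_pos hγ hs; linarith
  obtain ⟨C, hC, t0, hb⟩ := ((hφ a has).shift τ).bound
  refine EO.of_bound (C := A * C ^ (1 + γ)) (t0 := min t0 t1) fun t ht => ?_
  refine (hR t (ht.trans (min_le_right _ _))).trans ?_
  have h1 := hb t (ht.trans (min_le_left _ _))
  rw [abs_of_pos (hpos _)] at h1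
  have h2 := Real.rpow_le_rpow (hpos _).le h1 h1γ.le
  rw [Real.mul_rpow hC.le (Real.exp_pos _).le, ← Real.exp_mul] at h2
  rw [mul_assoc]
  refine mul_le_mul_of_nonneg_left (h2.trans_eq ?_) hA.le
  rw [← haa]; ring_nf

lemma SemiWavefront.prof {g φ : ℝ → ℝ} {c h : ℝ} (hφ : SemiWavefront g c h φ)
    (hg_nonneg : ∀ x : ℝ, 0 ≤ x → 0 ≤ g x) (hg_C1 : ContDiff ℝ 1 g) (hg0 : g 0 = 0)
    (hg'0 : 1 < deriv g 0) (hc : 0 < c) (hh : 0 ≤ h) :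
    Prof φ (deriv φ) (deriv (deriv φ)) (fun t => deriv g 0 * φ (t - c * h) - g (φ (t - c * h)))
      (deriv g 0) c (c * h) := by
  obtain ⟨hpos, hC2, heq, hlim, -⟩ := hφ
  have hd1 : Differentiable ℝ φ := hC2.differentiable (by norm_num)
  have hC1 : ContDiff ℝ 1 (deriv φ) := by
    have : ContDiff ℝ (1 + 1) φ := by simpa [one_add_one_eq_two] using hC2
    exact (contDiff_succ_iff_deriv.1 this).2.2
  have hd2 : Differentiable ℝ (deriv φ) := hC1.differentiable (by norm_num)
  have hc2 : Continuous (deriv (deriv φ)) := hC1.continuous_deriv (by norm_num)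
  have hcφ : Continuous φ := hd1.continuous
  have hcg : Continuous g := hg_C1.continuous
  have hgd : Differentiable ℝ g := hg_C1.differentiable (by norm_num)
  have hsh : Tendsto (fun t => φ (t - c * h)) atBot (nhds 0) :=
    hlim.comp (tendsto_atBot_add_const_right atBot (-(c * h)) tendsto_id)
  refine ⟨hpos, fun t => (hd1 t).hasDerivAt, fun t => (hd2 t).hasDerivAt, hc2, by fun_prop,
    fun t => ?_, fun η hη => ?_, hlim, hg'0, hc, mul_nonneg hc.le hh, fun t => ?_⟩
  · have := heq t
    linear_combination this
  · have h1 := (hgd 0).hasDerivAt.isLittleO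
    have h2 := (h1.comp_tendsto hsh).bound hη
    obtain ⟨t0, h3⟩ := eventually_atBot.1 h2
    refine ⟨t0, fun t ht => ?_⟩
    have h4 := h3 t ht
    simp only [Function.comp, sub_zero, hg0, smul_eq_mul, Real.norm_eq_abs, abs_of_pos (hpos _)] at h4
    rw [abs_sub_comm, mul_comm (deriv g 0)]
    exact h4
  · have := hg_nonneg _ (hpos (t - c * h)).le
    linarith

lemma chi0_eq (b c h z : ℝ) : chi0 b c h z = chiF b c (c * h) z := by
  simp only [chi0, chiF, mul_assoc]

/-- Asymptotic representation at `-∞` of a semi-wavefront profile: if `c > c_#(h)` the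
profile behaves like `e^{λ_j t}` for `j ∈ {1,2}` (the two positive roots of `χ(·,c)`),
while for the critical speed `c = c_#(h)` it behaves like `(-At+B)e^{λ t} + O(e^{λ t})`
with `A, B ≥ 0`, `A + B > 0`, `λ` the double positive root. -/
theorem semi_wavefront_asymptotics
    (g : ℝ → ℝ) (κ θ A δ γ : ℝ)
    (hg_nonneg : ∀ x : ℝ, 0 ≤ x → 0 ≤ g x)
    (hg_C1 : ContDiff ℝ 1 g)
    (hg0 : g 0 = 0)
    (hg'0 : 1 < deriv g 0)
    (hκ : 0 < κ)
    (hfix : ∀ x : ℝ, 0 ≤ x → (g x = x ↔ x = 0 ∨ x = κ))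
    (hθ1 : 0 < θ) (hθ2 : θ < κ)
    (hUinc : StrictMonoOn g (Ico 0 θ))
    (hUdec : StrictAntiOn g (Ici θ))
    (hA : 0 < A) (hδ1 : 0 < δ) (hδ2 : δ < θ) (hγ1 : 0 < γ) (hγ2 : γ ≤ 1)
    (hHolder : ∀ u ∈ Icc 0 δ, |deriv g u - deriv g 0| ≤ A * u ^ γ)
    (h c : ℝ) (hh : 0 ≤ h)
    (csharp : ℝ) (hcsharp_pos : 0 < csharp)
    (hcsharp : ∃ z : ℝ, 0 < z ∧ chi0 (deriv g 0) csharp h z = 0 ∧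
      2 * z - csharp - deriv g 0 * csharp * h * Real.exp (-(z * csharp * h)) = 0)
    (hcsharp_uniq : ∀ c' : ℝ, 0 < c' →
      (∃ z : ℝ, 0 < z ∧ chi0 (deriv g 0) c' h z = 0 ∧
        2 * z - c' - deriv g 0 * c' * h * Real.exp (-(z * c' * h)) = 0) → c' = csharp)
    (φ : ℝ → ℝ) (hφ : SemiWavefront g c h φ) :
    (∀ lam1 lam2 : ℝ, csharp < c →
      0 < lam2 → lam2 < lam1 →
      chi0 (deriv g 0) c h lam2 = 0 → chi0 (deriv g 0) c h lam1 = 0 →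
      (∀ z : ℝ, 0 < z → chi0 (deriv g 0) c h z = 0 → z = lam1 ∨ z = lam2) →
      ∃ s0 σ lam : ℝ, 0 < σ ∧ (lam = lam1 ∨ lam = lam2) ∧
        ((fun t => φ (t + s0) - Real.exp (lam * t)) =O[atBot]
          fun t => Real.exp ((lam + σ) * t)) ∧
        ((fun t => deriv φ (t + s0) - lam * Real.exp (lam * t)) =O[atBot]
          fun t => Real.exp ((lam + σ) * t))) ∧
    (∀ lam : ℝ, c = csharp → 0 < lam →
      chi0 (deriv g 0) c h lam = 0 →
      2 * lam - c - deriv g 0 * c * h * Real.exp (-(lam * c * h)) = 0 →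
      ∃ s0 A' B' : ℝ, 0 ≤ A' ∧ 0 ≤ B' ∧ 0 < A' + B' ∧
        ((fun t => φ (t + s0) - (-A' * t + B') * Real.exp (lam * t)) =O[atBot]
          fun t => Real.exp (lam * t)) ∧
        ((fun t => deriv φ (t + s0) - lam * (-A' * t + B') * Real.exp (lam * t)) =O[atBot]
          fun t => Real.exp (lam * t))) := by
  have hgd : Differentiable ℝ g := hg_C1.differentiable (by norm_num)
  have main : 0 < c → ∃ s > 0, chi0 (deriv g 0) c h s = 0 ∧ (∀ a < s, EO φ a) ∧
      (∀ a > s, ¬ EO φ a) ∧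
      EO (fun t => deriv g 0 * φ (t - c * h) - g (φ (t - c * h))) (s + γ * s / 2) := by
    intro hc
    have P := hφ.prof hg_nonneg hg_C1 hg0 hg'0 hc hh
    obtain ⟨s, hs, hsr, h1, h2⟩ := P.abscissa
    refine ⟨s, hs, by rw [chi0_eq]; exact hsr, h1, h2, ?_⟩
    have hsh : Tendsto (fun t => φ (t - c * h)) atBot (nhds 0) :=
      P.lim.comp (tendsto_atBot_add_const_right atBot (-(c * h)) tendsto_id)
    obtain ⟨t1, ht1⟩ := eventually_atBot.1 (hsh.eventually (ge_mem_nhds hδ1))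
    exact R_decay (t1 := t1) hA hγ1 hs P.pos
      (fun t ht => holder_bound hgd hg0 hA hγ1 hHolder _ (P.pos _) (ht1 t ht)) h1
  constructor
  · intro lam1 lam2 hcc hl2 hl12 hr2 hr1 huniq
    have hc : 0 < c := hcsharp_pos.trans hcc
    have P := hφ.prof hg_nonneg hg_C1 hg0 hg'0 hc hh
    obtain ⟨s, hs, hsr, h1, h2, hR⟩ := main hc
    rw [chi0_eq] at hr1 hr2
    have hκ' := kF_int_ne hl12 hr1 hr2
    have hγs : 0 < γ * s / 2 := by positivity
    rcases huniq s hs hsr with rfl | rfl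
    · obtain ⟨m, e0, e1⟩ := caseB P hr1 hl12 hκ' h1 hγs hR
      obtain ⟨s0, f0, f1⟩ := final_super P hs hγs h2 e0 e1
      exact ⟨s0, _, _, hγs, Or.inl rfl, f0, f1⟩
    · have hσ : 0 < min (γ * s / 2) ((lam1 - s) / 2) := lt_min hγs (by linarith)
      have hσ2 : min (γ * s / 2) ((lam1 - s) / 2) < lam1 - s :=
        (min_le_right _ _).trans_lt (by linarith)
      obtain ⟨m, e0, e1⟩ := caseA P hr1 hl12 hκ' h1 hσ hσ2
        (hR.mono (by linarith [min_le_left (γ * s / 2) ((lam1 - s) / 2)]))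
      obtain ⟨s0, f0, f1⟩ := final_super P hs hσ h2 e0 e1
      exact ⟨s0, _, _, hσ, Or.inr rfl, f0, f1⟩
  · intro lam hcc hl hr hr'
    have hc : 0 < c := by rw [hcc]; exact hcsharp_pos
    have P := hφ.prof hg_nonneg hg_C1 hg0 hg'0 hc hh
    obtain ⟨s, hs, hsr, h1, -, hR⟩ := main hc
    rw [chi0_eq] at hr hsr
    have hr2 : 2 * lam - c - deriv g 0 * (c * h) * Real.exp (-(lam * (c * h))) = 0 := by
      rw [← mul_assoc, ← mul_assoc]; exact hr'
    obtain rfl := chiF_unique (by linarith) hr hr2 hsr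
    have hγs : 0 < γ * s / 2 := by positivity
    obtain ⟨m, hm, e0, e1⟩ := caseC P hr (kF_int_eq hr2) h1 hγs hR
    refine ⟨0, -m, 1, by linarith, by norm_num, by linarith, ?_, ?_⟩
    · exact (e0.sub (EO.exp s)).congr' (fun t => by rw [add_zero]; ring) rfl
    · exact (e1.sub ((EO.exp s).const_mul s)).congr' (fun t => by rw [add_zero]; ring) rfl
end
end

section
/- Let c, h > 0 and a = g'(κ) < 0 be such that χ_κ(z) = z² − cz − 1 + a e^{−zch} has exactly three real zeros counting multiplicity, μ₃ ≤ μ₂ < 0 < μ₁ (i.e. (h,c) ∈ D_κ). Then every non-real complex zero μ of χ_κ satisfies Re μ < μ₃. -/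
open Filter Set

noncomputable section

/-- The characteristic function `χ_κ(z) = z² - cz - 1 + a e^{-zch}` at the positive
equilibrium (`a = g'(κ)`), as a function of the complex variable `z`. -/
def chiKC (c h a : ℝ) (z : ℂ) : ℂ :=
  z ^ 2 - (c : ℂ) * z - 1 + (a : ℂ) * Complex.exp (-(z * c * h))

lemma cz_core (α β τ y X : ℝ) (m : ℝ → ℝ) (hβ : α < β) (hτ : 0 < τ) (hy : 0 < y)
    (hX : 0 ≤ X) (hm0 : m 0 = 0)
    (hm : ∀ t, HasDerivAt m (Real.exp (-α * t) - Real.exp (-β * t)) t)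
    (w : ℂ) (hw : w = X + y * Complex.I)
    (P : ℝ → ℂ) (hP : ∀ t : ℝ, HasDerivAt P ((m t : ℂ) * Complex.exp (w * t)) t)
    (hPe : P τ = P 0) : False := by
  have hn : ∀ t, 0 < t → 0 < Real.exp (-α * t) - Real.exp (-β * t) := by
    intro t ht
    have : Real.exp (-β * t) < Real.exp (-α * t) := Real.exp_lt_exp.2 (by nlinarith)
    linarith
  have hmn : ∀ t, 0 ≤ t → 0 ≤ m t := by
    intro t ht
    have hmono : MonotoneOn m (Ici 0) := by
      apply monotoneOn_of_deriv_nonneg (convex_Ici 0)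
      · exact fun x _ => (hm x).continuousAt.continuousWithinAt
      · exact fun x _ => (hm x).differentiableAt.differentiableWithinAt
      · intro x hx
        rw [interior_Ici] at hx
        rw [(hm x).deriv]
        exact (hn x hx).le
    have := hmono (mem_Ici.2 le_rfl) (mem_Ici.2 ht) ht
    linarith
  let R : ℝ → ℝ := fun t => m t * Real.exp (X * t) * (1 - Real.cos (y * (t - τ)))
    - y * (Complex.exp (-(y * τ : ℝ) * Complex.I) * P t).im
  have hR : ∀ t, HasDerivAt R (((Real.exp (-α * t) - Real.exp (-β * t)) + X * m t)
      * Real.exp (X * t) * (1 - Real.cos (y * (t - τ)))) t := by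
    intro t
    have h1 : HasDerivAt (fun t : ℝ => Real.exp (X * t)) (Real.exp (X * t) * X) t := by
      simpa using ((hasDerivAt_id t).const_mul X).exp
    have h2 : HasDerivAt (fun t : ℝ => 1 - Real.cos (y * (t - τ)))
        (Real.sin (y * (t - τ)) * y) t := by
      simpa using ((((hasDerivAt_id t).sub_const τ).const_mul y).cos).const_sub 1
    have h3 := (hP t).const_mul (Complex.exp (-(y * τ : ℝ) * Complex.I))
    have h4 : HasDerivAt (fun t : ℝ => (Complex.exp (-(y * τ : ℝ) * Complex.I) * P t).im)
        (Complex.exp (-(y * τ : ℝ) * Complex.I) * ((m t : ℂ) * Complex.exp (w * t))).im t :=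
      Complex.imCLM.hasFDerivAt.comp_hasDerivAt t h3
    have h5 : (Complex.exp (-(y * τ : ℝ) * Complex.I) * ((m t : ℂ) * Complex.exp (w * t))).im
        = m t * Real.exp (X * t) * Real.sin (y * (t - τ)) := by
      have : Complex.exp (-(y * τ : ℝ) * Complex.I) * ((m t : ℂ) * Complex.exp (w * t))
          = (m t : ℂ) * (Complex.exp ((X * t : ℝ) + (y * (t - τ) : ℝ) * Complex.I)) := by
        rw [mul_left_comm, ← Complex.exp_add, hw]
        congr 2
        push_cast
        ring
      rw [this, Complex.im_ofReal_mul, Complex.exp_im]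
      simp [mul_assoc]
    rw [h5] at h4
    have h6 := (((hm t).mul h1).mul h2).sub (h4.const_mul y)
    refine HasDerivAt.congr_deriv h6 ?_
    simp only [Pi.mul_apply]
    ring
  have hRmono : MonotoneOn R (Icc 0 τ) := by
    apply monotoneOn_of_deriv_nonneg (convex_Icc 0 τ)
    · exact fun x _ => (hR x).continuousAt.continuousWithinAt
    · exact fun x _ => (hR x).differentiableAt.differentiableWithinAt
    · intro x hx
      rw [interior_Icc] at hx
      rw [(hR x).deriv]
      have h1 := hn x hx.1
      have h2 := hmn x hx.1.le
      have h3 := Real.cos_le_one (y * (x - τ))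
      have h4 : 0 ≤ 1 - Real.cos (y * (x - τ)) := by linarith
      positivity
  have hRe : R τ = R 0 := by
    simp [R, hm0, hPe]
  have hconst : ∀ t ∈ Icc 0 τ, R t = R 0 := by
    intro t ht
    have h1 := hRmono (left_mem_Icc.2 hτ.le) ht ht.1
    have h2 := hRmono ht (right_mem_Icc.2 hτ.le) ht.2
    linarith
  obtain ⟨δ, hδ0, hδ1, hδ2⟩ : ∃ δ : ℝ, 0 < δ ∧ δ < τ ∧ y * δ ≤ Real.pi := by
    refine ⟨min (τ / 2) (Real.pi / y), lt_min (by linarith) (div_pos Real.pi_pos hy), ?_, ?_⟩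
    · exact (min_le_left _ _).trans_lt (by linarith)
    · calc y * min (τ / 2) (Real.pi / y) ≤ y * (Real.pi / y) := by
            gcongr; exact min_le_right _ _
        _ = Real.pi := by field_simp
  have hd : HasDerivAt R 0 (τ - δ) := by
    have : R =ᶠ[nhds (τ - δ)] fun _ => R 0 := by
      filter_upwards [Icc_mem_nhds (show 0 < τ - δ by linarith) (show τ - δ < τ by linarith)]
        with t ht using hconst t ht
    exact (hasDerivAt_const _ _).congr_of_eventuallyEq this
  have he := (hR (τ - δ)).unique hd
  have h1 := hn (τ - δ) (by linarith)
  have h2 := hmn (τ - δ) (by linarith)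
  have h3 : Real.cos (y * (τ - δ - τ)) < 1 := by
    have h4 : y * (τ - δ - τ) = -(y * δ) := by ring
    rw [h4, Real.cos_neg]
    have := Real.cos_lt_cos_of_nonneg_of_le_pi le_rfl hδ2 (by positivity)
    simpa using this
  have h4 : 0 < 1 - Real.cos (y * (τ - δ - τ)) := by linarith
  have h5 : 0 < ((Real.exp (-α * (τ - δ)) - Real.exp (-β * (τ - δ))) + X * m (τ - δ))
      * Real.exp (X * (τ - δ)) * (1 - Real.cos (y * (τ - δ - τ))) := by positivity
  linarith

lemma cz_double (c τ b μ ν : ℝ) (hτ : 0 < τ) (hb : 0 < b) (hc : 0 < c) (hμ : μ < 0) (hν : 0 < ν)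
    (hz : μ ^ 2 - c * μ - 1 - b * Real.exp (-τ * μ) = 0)
    (hall : ∀ x : ℝ, x ^ 2 - c * x - 1 - b * Real.exp (-τ * x) = 0 → x = ν ∨ x = μ) :
    2 * μ - c + b * τ * Real.exp (-τ * μ) = 0 := by
  let f : ℝ → ℝ := fun x => x ^ 2 - c * x - 1 - b * Real.exp (-τ * x)
  have hcont : Continuous f := by fun_prop
  have hf0 : f 0 < 0 := by simp [f]; linarith
  have hneg : ∀ x, x < 0 → f x ≤ 0 := by
    intro x hx
    by_contra! hfx
    have hxμ : x ≠ μ := by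
      rintro rfl
      have : f x = 0 := hz
      linarith
    rcases lt_or_gt_of_ne hxμ with h | h
    · obtain ⟨Y, hY1, hY2, hY3⟩ : ∃ Y : ℝ, 1 ≤ Y ∧ -x ≤ Y ∧ 6 * (1 + c) / (b * τ ^ 3) ≤ Y :=
        ⟨max 1 (max (-x) (6 * (1 + c) / (b * τ ^ 3))), le_max_left _ _,
          (le_max_left _ _).trans (le_max_right _ _), (le_max_right _ _).trans (le_max_right _ _)⟩
      have hfY : f (-Y) ≤ 0 := by
        have h1 := Real.pow_div_factorial_le_exp (τ * Y) (by positivity) 3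
        have h2 : b * ((τ * Y) ^ 3 / 6) ≤ b * Real.exp (-τ * -Y) := by
          have : -τ * -Y = τ * Y := by ring
          rw [this]
          gcongr
          simpa [Nat.factorial] using h1
        rw [div_le_iff₀ (by positivity)] at hY3
        have h3 : (1 + c) * Y ^ 2 ≤ b * ((τ * Y) ^ 3 / 6) := by
          have := mul_le_mul_of_nonneg_right hY3 (sq_nonneg Y)
          nlinarith
        have h4 : c * Y ≤ c * Y ^ 2 := by
          have : Y ≤ Y ^ 2 := by nlinarith
          gcongr
        simp only [f]
        nlinarith
      obtain ⟨u, hu, hu0⟩ := intermediate_value_Icc (show -Y ≤ x by linarith)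
        hcont.continuousOn (show (0:ℝ) ∈ Icc (f (-Y)) (f x) from ⟨hfY, hfx.le⟩)
      rcases hall u hu0 with h' | h' <;> linarith [hu.2]
    · obtain ⟨u, hu, hu0⟩ := intermediate_value_Icc' hx.le
        hcont.continuousOn (show (0:ℝ) ∈ Icc (f 0) (f x) from ⟨hf0.le, hfx.le⟩)
      rcases hall u hu0 with h' | h' <;> linarith [hu.1, hu.2]
  have hmax : IsLocalMax f μ := by
    filter_upwards [Iio_mem_nhds hμ] with x hx
    have : f μ = 0 := hz
    rw [this]
    exact hneg x hx
  have hd : HasDerivAt f (2 * μ - c + b * τ * Real.exp (-τ * μ)) μ := by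
    have h1 : HasDerivAt (fun x : ℝ => Real.exp (-τ * x)) (Real.exp (-τ * μ) * -τ) μ := by
      simpa using ((hasDerivAt_id μ).const_mul (-τ)).exp
    have h2 := ((((hasDerivAt_id μ).pow 2).sub ((hasDerivAt_id μ).const_mul c)).sub_const 1).sub
      (h1.const_mul b)
    refine HasDerivAt.congr_deriv h2 ?_
    simp
    ring
  exact hmax.hasDerivAt_eq_zero hd

lemma cz_real (c h a x : ℝ) : chiKC c h a (x : ℂ) = 0 ↔
    x ^ 2 - c * x - 1 - (-a) * Real.exp (-(c * h) * x) = 0 := by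
  have : chiKC c h a (x : ℂ) = ((x ^ 2 - c * x - 1 - (-a) * Real.exp (-(c * h) * x) : ℝ) : ℂ) := by
    unfold chiKC
    push_cast
    rw [show -((x : ℂ) * c * h) = -(c * h) * x by ring]
    ring
  rw [this, Complex.ofReal_eq_zero]

lemma cz_pos (c h a : ℝ) (hc : 0 < c) (hh : 0 < h) (ha : a < 0)
    (μ₁ μ₂ μ₃ : ℝ)
    (hord1 : μ₃ ≤ μ₂) (hord2 : μ₂ < 0) (hord3 : 0 < μ₁)
    (hz1 : chiKC c h a (μ₁ : ℂ) = 0) (hz2 : chiKC c h a (μ₂ : ℂ) = 0)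
    (hz3 : chiKC c h a (μ₃ : ℂ) = 0)
    (hall : ∀ x : ℝ, chiKC c h a (x : ℂ) = 0 → x = μ₁ ∨ x = μ₂ ∨ x = μ₃)
    (μ : ℂ) (hμ : chiKC c h a μ = 0) (hy : 0 < μ.im) : μ.re < μ₃ := by
  by_contra! hre
  rw [cz_real] at hz1 hz2 hz3
  simp only [cz_real] at hall
  obtain ⟨τ, hτe⟩ : ∃ τ, τ = c * h := ⟨_, rfl⟩
  obtain ⟨b, hbe⟩ : ∃ b, b = -a := ⟨_, rfl⟩
  have hτ : 0 < τ := by rw [hτe]; positivity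
  have hb : 0 < b := by linarith
  rw [← hτe, ← hbe] at hz1 hz2 hz3
  rw [← hτe, ← hbe] at hall
  obtain ⟨B, hB⟩ : ∃ B, B = b * Real.exp (-τ * μ₃) := ⟨_, rfl⟩
  have hB0 : 0 < B := by rw [hB]; positivity
  have hB3 : B = μ₃ ^ 2 - c * μ₃ - 1 := by linarith
  have hB2 : B * Real.exp (-(μ₂ - μ₃) * τ) = μ₂ ^ 2 - c * μ₂ - 1 := by
    rw [hB, mul_assoc, ← Real.exp_add, show -τ * μ₃ + -(μ₂ - μ₃) * τ = -τ * μ₂ by ring]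
    linarith
  have hB1 : B * Real.exp (-(μ₁ - μ₃) * τ) = μ₁ ^ 2 - c * μ₁ - 1 := by
    rw [hB, mul_assoc, ← Real.exp_add, show -τ * μ₃ + -(μ₁ - μ₃) * τ = -τ * μ₁ by ring]
    linarith
  have hBw : (B : ℂ) * Complex.exp (-(μ - μ₃) * τ) = μ ^ 2 - c * μ - 1 := by
    rw [hB]
    push_cast
    rw [mul_assoc, ← Complex.exp_add, show -(τ : ℂ) * μ₃ + -(μ - μ₃) * τ = -(μ * c * h) by
      rw [hτe]; push_cast; ring, hbe]
    unfold chiKC at hμ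
    push_cast
    linear_combination -hμ
  have hβ0 : 0 < μ₁ - μ₃ := by linarith
  have hexp : ∀ k : ℝ, ∀ t, HasDerivAt (fun t : ℝ => Real.exp (-k * t)) (Real.exp (-k * t) * -k) t := by
    intro k t
    simpa using ((hasDerivAt_id t).const_mul (-k)).exp
  obtain ⟨m, hm0, hm, hmτ⟩ : ∃ m : ℝ → ℝ, m 0 = 0 ∧
      (∀ t, HasDerivAt m (Real.exp (-(μ₂ - μ₃) * t) - Real.exp (-(μ₁ - μ₃) * t)) t) ∧
      B * m τ = μ₁ - μ₂ := by
    rcases hord1.eq_or_lt with heq | hlt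
    · have hdd := cz_double c τ b μ₂ μ₁ hτ hb hc hord2 hord3 hz2 (by
        intro x hx
        rcases hall x hx with h' | h' | h'
        · exact Or.inl h'
        · exact Or.inr h'
        · exact Or.inr (h'.trans heq))
      rw [← heq] at hdd
      refine ⟨fun t => t - (1 - Real.exp (-(μ₁ - μ₃) * t)) / (μ₁ - μ₃), by simp, ?_, ?_⟩
      · intro t
        have := (hasDerivAt_id t).sub (((hexp (μ₁ - μ₃) t).const_sub 1).div_const (μ₁ - μ₃))
        refine HasDerivAt.congr_deriv this ?_
        rw [← heq]
        field_simp
        simp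
      · have h1 : B * ((1 - Real.exp (-(μ₁ - μ₃) * τ)) / (μ₁ - μ₃)) = -(μ₁ + μ₃ - c) := by
          rw [← mul_div_assoc, div_eq_iff hβ0.ne']
          linear_combination hB3 - hB1
        have h2 : B * τ = -(2 * μ₃ - c) := by rw [hB]; linarith
        rw [mul_sub, h1, h2, ← heq]
        ring
    · have hα0 : 0 < μ₂ - μ₃ := by linarith
      refine ⟨fun t => (1 - Real.exp (-(μ₂ - μ₃) * t)) / (μ₂ - μ₃)
        - (1 - Real.exp (-(μ₁ - μ₃) * t)) / (μ₁ - μ₃), by simp, ?_, ?_⟩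
      · intro t
        have := (((hexp (μ₂ - μ₃) t).const_sub 1).div_const (μ₂ - μ₃)).sub
          (((hexp (μ₁ - μ₃) t).const_sub 1).div_const (μ₁ - μ₃))
        refine HasDerivAt.congr_deriv this ?_
        field_simp
      · have h1 : B * ((1 - Real.exp (-(μ₁ - μ₃) * τ)) / (μ₁ - μ₃)) = -(μ₁ + μ₃ - c) := by
          rw [← mul_div_assoc, div_eq_iff hβ0.ne']
          linear_combination hB3 - hB1
        have h2 : B * ((1 - Real.exp (-(μ₂ - μ₃) * τ)) / (μ₂ - μ₃)) = -(μ₂ + μ₃ - c) := by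
          rw [← mul_div_assoc, div_eq_iff hα0.ne']
          linear_combination hB3 - hB2
        rw [mul_sub, h1, h2]
        ring
  have hne : ∀ r : ℝ, μ - r ≠ 0 := by
    intro r hr
    have := congrArg Complex.im hr
    simp at this
    linarith
  have hn1 := hne μ₁
  have hn2 := hne μ₂
  have hn3 := hne μ₃
  have hcexp : ∀ k : ℂ, ∀ t : ℝ, HasDerivAt (fun t : ℝ => Complex.exp (k * t))
      (Complex.exp (k * t) * k) t := by
    intro k t
    have h1 : HasDerivAt (fun t : ℝ => (t : ℂ)) 1 t := by
      simpa using (hasDerivAt_id t).ofReal_comp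
    simpa using (h1.const_mul k).cexp
  refine cz_core (μ₂ - μ₃) (μ₁ - μ₃) τ μ.im (μ.re - μ₃) m (by linarith) hτ hy (by linarith)
    hm0 hm (μ - μ₃) ?_ (fun t => ((m t : ℂ) * Complex.exp ((μ - μ₃) * t)
      - Complex.exp ((μ - μ₂) * t) / (μ - μ₂) + Complex.exp ((μ - μ₁) * t) / (μ - μ₁)) / (μ - μ₃))
      ?_ ?_
  · apply Complex.ext <;> simp
  · intro t
    have h1 := ((((hm t).ofReal_comp).mul (hcexp (μ - μ₃) t)).sub
      ((hcexp (μ - μ₂) t).div_const (μ - μ₂))).add ((hcexp (μ - μ₁) t).div_const (μ - μ₁))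
    refine HasDerivAt.congr_deriv (h1.div_const (μ - μ₃)) ?_
    rw [mul_div_cancel_right₀ _ hn2, mul_div_cancel_right₀ _ hn1, div_eq_iff hn3]
    have e2 : Complex.exp ((μ - μ₂) * t) =
        Complex.exp (-(μ₂ - μ₃) * t) * Complex.exp ((μ - μ₃) * t) := by
      rw [← Complex.exp_add]; congr 1; ring
    have e1 : Complex.exp ((μ - μ₁) * t) =
        Complex.exp (-(μ₁ - μ₃) * t) * Complex.exp ((μ - μ₃) * t) := by
      rw [← Complex.exp_add]; congr 1; ring
    rw [e1, e2]
    push_cast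
    ring
  · have hE : (B : ℂ) * Complex.exp (-(μ - μ₃) * τ) ≠ 0 :=
      mul_ne_zero (by exact_mod_cast hB0.ne') (Complex.exp_ne_zero _)
    have hB1' : (B : ℂ) * Complex.exp (-(μ₁ - μ₃) * τ) = μ₁ ^ 2 - c * μ₁ - 1 := by
      exact_mod_cast congrArg (fun r : ℝ => (r : ℂ)) hB1
    have hB2' : (B : ℂ) * Complex.exp (-(μ₂ - μ₃) * τ) = μ₂ ^ 2 - c * μ₂ - 1 := by
      exact_mod_cast congrArg (fun r : ℝ => (r : ℂ)) hB2
    have hmτ' : (B : ℂ) * m τ = μ₁ - μ₂ := by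
      exact_mod_cast congrArg (fun r : ℝ => (r : ℂ)) hmτ
    have e3 : Complex.exp (-(μ - μ₃) * τ) * Complex.exp ((μ - μ₃) * τ) = 1 := by
      rw [← Complex.exp_add, ← Complex.exp_zero]; congr 1; ring
    have e2 : Complex.exp (-(μ - μ₃) * τ) * Complex.exp ((μ - μ₂) * τ) =
        Complex.exp (-(μ₂ - μ₃) * τ) := by
      rw [← Complex.exp_add]; congr 1; ring
    have e1 : Complex.exp (-(μ - μ₃) * τ) * Complex.exp ((μ - μ₁) * τ) =
        Complex.exp (-(μ₁ - μ₃) * τ) := by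
      rw [← Complex.exp_add]; congr 1; ring
    simp only [hm0]
    congr 1
    apply mul_left_cancel₀ hE
    simp only [Complex.ofReal_zero, mul_zero, Complex.exp_zero, zero_mul]
    have g2 : (B : ℂ) * Complex.exp (-(μ - μ₃) * τ) * (Complex.exp ((μ - μ₂) * τ) / (μ - μ₂))
        - (B : ℂ) * Complex.exp (-(μ - μ₃) * τ) * (1 / (μ - μ₂)) = -(μ + μ₂ - c) := by
      rw [← mul_sub, ← sub_div, ← mul_div_assoc, div_eq_iff hn2]
      linear_combination (B : ℂ) * e2 + hB2' - hBw
    have g1 : (B : ℂ) * Complex.exp (-(μ - μ₃) * τ) * (Complex.exp ((μ - μ₁) * τ) / (μ - μ₁))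
        - (B : ℂ) * Complex.exp (-(μ - μ₃) * τ) * (1 / (μ - μ₁)) = -(μ + μ₁ - c) := by
      rw [← mul_sub, ← sub_div, ← mul_div_assoc, div_eq_iff hn1]
      linear_combination (B : ℂ) * e1 + hB1' - hBw
    linear_combination g1 - g2 + hmτ' + (B : ℂ) * m τ * e3

/-- If `χ_κ` has exactly three real zeros counting multiplicity, `μ₃ ≤ μ₂ < 0 < μ₁`,
then every non-real complex zero `μ` of `χ_κ` satisfies `Re μ < μ₃`. -/
theorem complex_zeros_dominated
    (c h a : ℝ) (hc : 0 < c) (hh : 0 < h) (ha : a < 0)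
    (μ₁ μ₂ μ₃ : ℝ)
    (hord1 : μ₃ ≤ μ₂) (hord2 : μ₂ < 0) (hord3 : 0 < μ₁)
    (hz1 : chiKC c h a (μ₁ : ℂ) = 0) (hz2 : chiKC c h a (μ₂ : ℂ) = 0)
    (hz3 : chiKC c h a (μ₃ : ℂ) = 0)
    (hall : ∀ x : ℝ, chiKC c h a (x : ℂ) = 0 → x = μ₁ ∨ x = μ₂ ∨ x = μ₃) :
    ∀ μ : ℂ, chiKC c h a μ = 0 → μ.im ≠ 0 → μ.re < μ₃ := by
  intro μ hμ hy
  rcases lt_or_gt_of_ne hy with hy | hy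
  · have hconj : chiKC c h a ((starRingEnd ℂ) μ) = 0 := by
      have h1 := congrArg (starRingEnd ℂ) hμ
      unfold chiKC at h1 ⊢
      simpa [← Complex.exp_conj] using h1
    have := cz_pos c h a hc hh ha μ₁ μ₂ μ₃ hord1 hord2 hord3 hz1 hz2 hz3 hall _ hconj (by simpa using hy)
    simpa using this
  · exact cz_pos c h a hc hh ha μ₁ μ₂ μ₃ hord1 hord2 hord3 hz1 hz2 hz3 hall μ hμ hy
end
end
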